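/- Let G be a bridgeless cubic graph with a 2-factor consisting of two odd circuits C1 and C2. Let u1u2 be an edge of G with u1 ∈ V(C1) and u2 ∈ V(C2), and let M be the perfect matching of G such that u1u2 ∈ M and M \ {u1u2} ⊆ E(C1) ∪ E(C2). For i = 1, 2, let C_{i+2} be the circuit containing u_i in the subgraph of G induced by the edge set E(G) \ M. Suppose C3 ≠ C4, and suppose G has a circuit C containing u1 such that: (1) (E(C1) \ M) \ E(C) is a perfect matching of C1 − (V(C) ∩ V(C1)); (2) ∅ ≠ E(C) ∩ E(C2) ⊆ E(C2) \ M and E(C) ∩ E(C2) ∩ E(C4) = ∅; and (3) the paths Q1, Q2, …, Qs into which the edges of E(C) ∩ E(C2) separate C satisfy that for each i ∈ {1,…,s}, if u1 ∉ V(Q_i) then E(Q_i) ∩ (E(C1) \ M) is a perfect matching of Q_i − (V(Q_i) ∩ V(C2)). Then G has 3 perfect matchings that together cover all edges of (E(C1) ∪ E(C2)) \ M. -/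

import Mathlib

/-- A multigraph on vertex type `V` with edge type `E`: each edge is assigned an
unordered pair of distinct endpoints (multiple edges allowed, loops forbidden). -/
structure Multigraph (V : Type*) (E : Type*) where
  inc : E → Sym2 V
  no_loops : ∀ e : E, ¬ (inc e).IsDiag

namespace Multigraph

variable {V E : Type*} (G : Multigraph V E)

/-- The set of vertices incident with some edge in the edge set `F`. -/
def supp (F : Set E) : Set V := {v | ∃ e ∈ F, v ∈ G.inc e}

/-- The degree of a vertex `v` in the subgraph given by the edge set `F`. -/
noncomputable def deg (F : Set E) (v : V) : ℕ := {e ∈ F | v ∈ G.inc e}.ncard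

/-- `G` is cubic, i.e. 3-regular. -/
def IsCubic : Prop := ∀ v : V, G.deg Set.univ v = 3

/-- Adjacency via an edge of the edge set `F`. -/
def Adj (F : Set E) (u v : V) : Prop := ∃ e ∈ F, G.inc e = s(u, v)

/-- `u` and `v` are joined by a walk using only edges of `F`. -/
def Reach (F : Set E) : V → V → Prop := Relation.ReflTransGen (G.Adj F)

/-- `G` is bridgeless: no edge is a cut edge, i.e. the ends of every edge are
joined by a walk avoiding that edge. -/
def Bridgeless : Prop :=
  ∀ e : E, ∀ u v : V, G.inc e = s(u, v) → G.Reach (Set.univ \ {e}) u v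

/-- `M` is a perfect matching of the subgraph of `G` with vertex set `S` whose
edges are the edges of `F` having both ends in `S`: the edges of `M` lie in `F`,
have both ends in `S`, and every vertex of `S` lies on exactly one edge of `M`. -/
def IsPMOn (S : Set V) (F : Set E) (M : Set E) : Prop :=
  M ⊆ F ∧ (∀ e ∈ M, ∀ v ∈ G.inc e, v ∈ S) ∧ ∀ v ∈ S, ∃! e, e ∈ M ∧ v ∈ G.inc e

/-- `M` is a perfect matching of `G`. -/
def IsPM (M : Set E) : Prop := G.IsPMOn Set.univ Set.univ M

/-- The edge set `C` is a circuit of `G`: nonempty, 2-regular, and connected. -/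
def IsCircuit (C : Set E) : Prop :=
  C.Nonempty ∧ (∀ v ∈ G.supp C, G.deg C v = 2) ∧
    ∀ u ∈ G.supp C, ∀ v ∈ G.supp C, G.Reach C u v

end Multigraph


/-- A skew-symmetric digraph: `ν` is an involution reversing the arcs `R`, and `tok` sends a
vertex to the name of its `ν`-orbit. -/
structure SkewGraph (D E : Type*) where
  ν : D → D
  tok : D → E
  R : D → D → Prop
  ν_ν : ∀ d, ν (ν d) = d
  tok_ν : ∀ d, tok (ν d) = tok d
  eq_or_eq_ν : ∀ a b, tok a = tok b → a = b ∨ ν a = b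
  R_ν : ∀ a b, R a b → R (ν b) (ν a)

namespace SkewGraph

variable {D E : Type*} (S : SkewGraph D E)

/-- The tokens of the entries of a list. -/
def toks (l : List D) : Set E := {e | ∃ d ∈ l, S.tok d = e}

/-- The entries of a list have distinct tokens. -/
def Distinct (l : List D) : Prop := l.Pairwise fun a b => S.tok a ≠ S.tok b

/-- The reversed list, with all entries replaced by their mirror images. -/
def mirror (l : List D) : List D := (l.map S.ν).reverse

/-- `l` is a regular path from `s` to `t`: it follows the arcs and has distinct tokens. -/
structure IsPath (s t : D) (l : List D) : Prop where
  chain : l.IsChain S.R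
  distinct : S.Distinct l
  head : l.head? = some s
  last : l.getLast? = some t

@[simp, grind =] lemma mem_toks_nil (e : E) : e ∈ S.toks [] ↔ False := by simp [toks]

@[simp, grind =] lemma mem_toks_cons (d : D) (l : List D) (e : E) :
    e ∈ S.toks (d :: l) ↔ e = S.tok d ∨ e ∈ S.toks l := by
  simp [toks, eq_comm]

@[simp, grind =] lemma mem_toks_append (a b : List D) (e : E) :
    e ∈ S.toks (a ++ b) ↔ e ∈ S.toks a ∨ e ∈ S.toks b := by
  simp only [toks, List.mem_append, Set.mem_ofPred_eq]
  grind

lemma tok_mem_toks {d : D} {l : List D} (h : d ∈ l) : S.tok d ∈ S.toks l := ⟨d, h, rfl⟩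

@[simp] lemma mem_mirror (d : D) (l : List D) : d ∈ S.mirror l ↔ S.ν d ∈ l := by
  simp only [mirror, List.mem_reverse, List.mem_map]
  constructor
  · rintro ⟨a, ha, rfl⟩
    rwa [S.ν_ν]
  · exact fun h => ⟨_, h, S.ν_ν d⟩

@[simp, grind =] lemma mem_toks_mirror (l : List D) (e : E) :
    e ∈ S.toks (S.mirror l) ↔ e ∈ S.toks l := by
  simp only [toks, Set.mem_ofPred_eq, mem_mirror]
  constructor
  · rintro ⟨d, hd, rfl⟩
    exact ⟨_, hd, S.tok_ν d⟩
  · rintro ⟨d, hd, rfl⟩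
    exact ⟨S.ν d, by rwa [S.ν_ν], S.tok_ν d⟩

@[simp, grind =] lemma mirror_nil : S.mirror [] = [] := rfl

@[simp, grind =] lemma mirror_append (a b : List D) :
    S.mirror (a ++ b) = S.mirror b ++ S.mirror a := by simp [mirror]

@[simp, grind =] lemma mirror_cons (d : D) (l : List D) :
    S.mirror (d :: l) = S.mirror l ++ [S.ν d] := by simp [mirror]

@[simp] lemma mirror_mirror (l : List D) : S.mirror (S.mirror l) = l := by
  simp [mirror, Function.comp_def, S.ν_ν]

@[simp] lemma length_mirror (l : List D) : (S.mirror l).length = l.length := by simp [mirror]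

attribute [grind =] ν_ν tok_ν mirror_mirror

@[grind =] lemma distinct_cons (d : D) (l : List D) :
    S.Distinct (d :: l) ↔ S.tok d ∉ S.toks l ∧ S.Distinct l := by
  simp only [Distinct, List.pairwise_cons, toks, Set.mem_ofPred_eq]
  grind

@[grind =] lemma distinct_append (a b : List D) :
    S.Distinct (a ++ b) ↔ S.Distinct a ∧ S.Distinct b ∧ ∀ e ∈ S.toks a, e ∉ S.toks b := by
  simp only [Distinct, List.pairwise_append, toks, Set.mem_ofPred_eq]
  grind

@[grind =] lemma distinct_nil : S.Distinct [] ↔ True := by simp [Distinct]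

@[grind =] lemma distinct_mirror (l : List D) : S.Distinct (S.mirror l) ↔ S.Distinct l := by
  simp only [Distinct, mirror, List.pairwise_reverse, List.pairwise_map, S.tok_ν]
  simp only [ne_comm]

lemma isChain_mirror {l : List D} (h : l.IsChain S.R) : (S.mirror l).IsChain S.R := by
  rw [mirror, List.isChain_reverse, List.isChain_map]
  exact h.imp fun a b => S.R_ν a b

lemma exists_split {l : List D} {e : E} (h : e ∈ S.toks l) :
    ∃ a d b, l = a ++ d :: b ∧ S.tok d = e := by
  obtain ⟨d, hd, rfl⟩ := h
  obtain ⟨a, b, rfl⟩ := List.append_of_mem hd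
  exact ⟨a, d, b, rfl, rfl⟩

/-- The first entry of a list with token in `X`. -/
lemma exists_first {l : List D} {X : Set E} (h : ∃ e ∈ S.toks l, e ∈ X) :
    ∃ a d b, l = a ++ d :: b ∧ S.tok d ∈ X ∧ ∀ e ∈ S.toks a, e ∉ X := by
  induction l with
  | nil => simp at h
  | cons u l ih =>
    by_cases hu : S.tok u ∈ X
    · exact ⟨[], u, l, rfl, hu, by simp⟩
    · obtain ⟨a, d, b, rfl, hd, ha⟩ := ih (by grind)
      exact ⟨u :: a, d, b, rfl, hd, by grind⟩

/-- The last entry of a list with token in `X`. -/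
lemma exists_last {l : List D} {X : Set E} (h : ∃ e ∈ S.toks l, e ∈ X) :
    ∃ a d b, l = a ++ d :: b ∧ S.tok d ∈ X ∧ ∀ e ∈ S.toks b, e ∉ X := by
  induction l with
  | nil => simp at h
  | cons u l ih =>
    by_cases hl : ∃ e ∈ S.toks l, e ∈ X
    · obtain ⟨a, d, b, rfl, hd, ha⟩ := ih hl
      exact ⟨u :: a, d, b, rfl, hd, ha⟩
    · exact ⟨[], u, l, rfl, by grind, by grind⟩

/-- A list containing the token of `d` contains `d` or its mirror image. -/
lemma exists_split_or {l : List D} {d : D} (h : S.tok d ∈ S.toks l) :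
    (∃ a b, l = a ++ d :: b) ∨ ∃ a b, l = a ++ S.ν d :: b := by
  obtain ⟨a, d', b, rfl, hd⟩ := S.exists_split h
  obtain rfl | rfl := S.eq_or_eq_ν _ _ hd.symm
  · exact .inl ⟨a, b, rfl⟩
  · exact .inr ⟨a, b, rfl⟩

namespace IsPath

variable {S} {s t s' t' w : D} {l a b x y : List D}

lemma mirror (h : S.IsPath s t l) : S.IsPath (S.ν t) (S.ν s) (S.mirror l) where
  chain := S.isChain_mirror h.chain
  distinct := by rw [distinct_mirror]; exact h.distinct
  head := by simp [SkewGraph.mirror, List.head?_reverse, h.last]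
  last := by simp [SkewGraph.mirror, List.getLast?_reverse, h.head]

lemma splice (h : S.IsPath s t (a ++ w :: x)) (h' : S.IsPath s' t' (y ++ w :: b))
    (hab : ∀ e ∈ S.toks a, e ∉ S.toks b) : S.IsPath s t' (a ++ w :: b) where
  chain := by
    rw [List.isChain_split]
    exact ⟨(List.isChain_split.1 h.chain).1, (List.isChain_split.1 h'.chain).2⟩
  distinct := by
    have := h.distinct
    have := h'.distinct
    grind
  head := by
    have := h.head
    cases a <;> simpa using this
  last := by
    have := h'.last
    rw [List.getLast?_append_cons] at this ⊢
    exact this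

lemma take (h : S.IsPath s t (a ++ w :: b)) : S.IsPath s w (a ++ [w]) where
  chain := (List.isChain_split.1 h.chain).1
  distinct := by have := h.distinct; grind
  head := by
    have := h.head
    cases a <;> simpa using this
  last := by simp

end IsPath

end SkewGraph


namespace SkewGraph

variable {D E : Type*} {S : SkewGraph D E}

/-- Two places in a list are either equal or one of them precedes the other. -/
lemma split_cases {α : Type*} {a b c d : List α} {v w : α} (h : a ++ v :: b = c ++ w :: d) :
    (∃ r, c = a ++ v :: r ∧ b = r ++ w :: d) ∨ (a = c ∧ v = w ∧ b = d) ∨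
      ∃ r, a = c ++ w :: r ∧ d = r ++ v :: b := by
  rcases List.append_eq_append_iff.1 h with ⟨r, rfl, hr⟩ | ⟨r, rfl, hr⟩ <;> cases r <;> grind

variable (S) in
/-- There are two regular paths, each starting in `σ` or `σ'` and ending in `τ` or `τ'`, whose
common tokens all lie in `O`. -/
def Pair (σ σ' τ τ' : D) (O : Set E) : Prop :=
  ∃ s s' t t' Z Z', (s = σ ∨ s = σ') ∧ (s' = σ ∨ s' = σ') ∧ (t = τ ∨ t = τ') ∧
    (t' = τ ∨ t' = τ') ∧ S.IsPath s t Z ∧ S.IsPath s' t' Z' ∧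
    ∀ e ∈ S.toks Z, e ∈ S.toks Z' → e ∈ O

variable {σ σ' τ τ' s s' t t' x y g h : D} {O X : Set E}
  {A K B LC c1 c2 c3 c4 w0 w1 v0 v1 : List D}

lemma Pair.swap_left (hp : S.Pair σ' σ τ τ' O) : S.Pair σ σ' τ τ' O := by
  unfold Pair at *; grind

lemma Pair.swap_right (hp : S.Pair σ σ' τ' τ O) : S.Pair σ σ' τ τ' O := by
  unfold Pair at *; grind

/-- Build a pair of paths from a path `w0 ++ [S.ν x]` that is continued backwards along `LC`,
and a path `v0 ++ [h]` that is continued forwards along `LC`. -/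
lemma pair_first (hs : s = σ ∨ s = σ') (hs' : s' = σ ∨ s' = σ')
    (hC : S.IsPath (S.ν τ) τ' LC) (hx : LC = c1 ++ x :: c2)
    (hW : S.IsPath s t (w0 ++ S.ν x :: w1)) (hU : S.IsPath s' t' (v0 ++ h :: v1))
    (hh : h ∈ LC) (hc : S.tok h ∉ S.toks c1) (hw0 : ∀ e ∈ S.toks w0, e ∉ S.toks c1)
    (hv0 : ∀ e ∈ S.toks v0, e ∉ S.toks LC)
    (hO : ∀ e, e ∈ S.toks w0 ∨ e = S.tok x → e ∈ S.toks v0 ∨ e ∈ S.toks LC → e ∈ O) :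
    S.Pair σ σ' τ τ' O := by
  obtain ⟨m1, m2, hm⟩ := List.append_of_mem hh
  have hC' := hC.mirror
  have hm' : S.mirror LC = S.mirror c2 ++ S.ν x :: S.mirror c1 := by rw [hx]; simp
  have hC2 := hC
  rw [hm] at hC2
  rw [hm', S.ν_ν] at hC'
  refine ⟨s, s', τ, τ', _, _, hs, hs', .inl rfl, .inr rfl, hW.splice hC' (by grind),
    hU.splice hC2 (by grind), ?_⟩
  have hd := hC.distinct
  have := split_cases (hx.symm.trans hm)
  intro e he he'
  rcases this with ⟨r, rfl, rfl⟩ | ⟨rfl, rfl, rfl⟩ | ⟨r, rfl, rfl⟩ <;> grind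

lemma pair_last (hs : s = σ ∨ s = σ') (hs' : s' = σ ∨ s' = σ')
    (hC : S.IsPath (S.ν τ) τ' LC) (hy : LC = c3 ++ y :: c4)
    (hW : S.IsPath s t (w0 ++ y :: w1)) (hU : S.IsPath s' t' (v0 ++ g :: v1))
    (hg : S.ν g ∈ LC) (hc : S.tok g ∉ S.toks c4) (hw0 : ∀ e ∈ S.toks w0, e ∉ S.toks c4)
    (hv0 : ∀ e ∈ S.toks v0, e ∉ S.toks LC)
    (hO : ∀ e, e ∈ S.toks w0 ∨ e = S.tok y → e ∈ S.toks v0 ∨ e ∈ S.toks LC → e ∈ O) :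
    S.Pair σ σ' τ τ' O := by
  have hC' := hC.mirror
  rw [S.ν_ν] at hC'
  refine (pair_first (x := S.ν y) (c1 := S.mirror c4) (c2 := S.mirror c3) (w0 := w0) (w1 := w1)
    (t := t) hs hs' hC' ?_ ?_ hU ?_ ?_ ?_ ?_ ?_).swap_right
  · rw [hy]; simp
  · rwa [S.ν_ν]
  · simpa using hg
  all_goals grind

variable (S) in
/-- A path `A ++ K ++ B` from `σ` back to `σ'` and a path `LC` from `τ` back to `τ'`; they have
common tokens, all of which belong to `K`. -/
structure Hub (X : Set E) (σ σ' τ τ' : D) (A K B LC : List D) : Prop where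
  path : S.IsPath σ (S.ν σ') (A ++ K ++ B)
  pathC : S.IsPath (S.ν τ) τ' LC
  sub : ∀ e ∈ S.toks K, e ∈ X
  hA : ∀ e ∈ S.toks A, e ∉ S.toks LC
  hB : ∀ e ∈ S.toks B, e ∉ S.toks LC
  meet : ∃ e ∈ S.toks K, e ∈ S.toks LC

lemma Hub.mirror_left (H : S.Hub X σ σ' τ τ' A K B LC) :
    S.Hub X σ' σ τ τ' (S.mirror B) (S.mirror K) (S.mirror A) LC where
  path := by
    have := H.path.mirror
    rw [S.ν_ν] at this
    simpa using this
  pathC := H.pathC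
  sub := by have := H.sub; grind
  hA := by have := H.hB; grind
  hB := by have := H.hA; grind
  meet := by have := H.meet; grind

lemma Hub.mirror_right (H : S.Hub X σ σ' τ τ' A K B LC) :
    S.Hub X σ σ' τ' τ A K B (S.mirror LC) where
  path := H.path
  pathC := by have := H.pathC.mirror; rwa [S.ν_ν] at this
  sub := H.sub
  hA := by have := H.hA; grind
  hB := by have := H.hB; grind
  meet := by have := H.meet; grind

variable (S) in
/-- A hub in which the first and the last common token of the two paths are traversed in the
way that does not immediately give a pair of paths. -/
structure Config (X : Set E) (σ σ' τ τ' : D) (A K B LC c1 c2 c3 c4 a1 a2 b1 b2 g1 g2 k1 k2 : List D)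
    (x y g h : D) : Prop where
  hub : S.Hub X σ σ' τ τ' A K B LC
  hCx : LC = c1 ++ x :: c2
  hCy : LC = c3 ++ y :: c4
  hc1 : ∀ e ∈ S.toks c1, e ∉ S.toks K
  hc4 : ∀ e ∈ S.toks c4, e ∉ S.toks K
  hx : K = a1 ++ x :: a2
  hy : K = b1 ++ y :: b2
  hg : K = g1 ++ g :: g2
  hh : K = k1 ++ h :: k2
  hg1 : ∀ e ∈ S.toks g1, e ∉ S.toks LC
  hk2 : ∀ e ∈ S.toks k2, e ∉ S.toks LC
  hνg : S.ν g ∈ LC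
  hνh : S.ν h ∈ LC

variable {a1 a2 b1 b2 g1 g2 k1 k2 : List D}

lemma Config.mirror
    (H : S.Config X σ σ' τ τ' A K B LC c1 c2 c3 c4 a1 a2 b1 b2 g1 g2 k1 k2 x y g h) :
    S.Config X σ' σ τ' τ (S.mirror B) (S.mirror K) (S.mirror A) (S.mirror LC)
      (S.mirror c4) (S.mirror c3) (S.mirror c2) (S.mirror c1)
      (S.mirror b2) (S.mirror b1) (S.mirror a2) (S.mirror a1)
      (S.mirror k2) (S.mirror k1) (S.mirror g2) (S.mirror g1) (S.ν y) (S.ν x) (S.ν h) (S.ν g) where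
  hub := H.hub.mirror_left.mirror_right
  hCx := by rw [H.hCy]; simp
  hCy := by rw [H.hCx]; simp
  hc1 := by have := H.hc4; grind
  hc4 := by have := H.hc1; grind
  hx := by rw [H.hy]; simp
  hy := by rw [H.hx]; simp
  hg := by rw [H.hh]; simp
  hh := by rw [H.hg]; simp
  hg1 := by have := H.hk2; grind
  hk2 := by have := H.hg1; grind
  hνg := by simpa [S.ν_ν] using H.hνh
  hνh := by simpa [S.ν_ν] using H.hνg

/-- A favourable orientation of the first common token gives a pair. -/
lemma Hub.pair_aux (H : S.Hub X σ σ' τ τ' A K B LC) (hCx : LC = c1 ++ x :: c2)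
    (hc1 : ∀ e ∈ S.toks c1, e ∉ S.toks K) (hx : K = a1 ++ S.ν x :: a2) (hh : K = k1 ++ h :: k2)
    (hk2 : ∀ e ∈ S.toks k2, e ∉ S.toks LC) (hνh : S.ν h ∈ LC) :
    S.Pair σ σ' τ τ' {e | e ∈ S.toks LC ∧ e ∈ X} := by
  have hP := H.path
  have hP' := H.mirror_left.path
  refine pair_first (s := σ) (s' := σ') (x := x) (h := S.ν h) (w0 := A ++ a1) (w1 := a2 ++ B)
    (v0 := S.mirror B ++ S.mirror k2) (v1 := S.mirror k1 ++ S.mirror A) (t := S.ν σ') (t' := S.ν σ)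
    (.inl rfl) (.inr rfl) H.pathC hCx ?_ ?_ hνh ?_ ?_ ?_ ?_
  · rw [hx] at hP; simpa using hP
  · rw [hh] at hP'; simpa using hP'
  · have : S.tok h ∈ S.toks K := by grind
    grind
  · have := H.hA; grind
  · have := H.hB; grind
  · have h1 := H.hA
    have h2 := H.hB
    have h3 := H.path.distinct
    have h4 := H.sub
    intro e he he'
    show _ ∧ _
    by_cases hL : e ∈ S.toks LC
    · refine ⟨hL, h4 e ?_⟩
      grind
    · exfalso
      have : S.tok x ∈ S.toks LC := by grind
      have h5 := split_cases (hx.symm.trans hh)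
      rcases h5 with ⟨r, rfl, rfl⟩ | ⟨rfl, rfl, rfl⟩ | ⟨r, rfl, rfl⟩ <;> grind

end SkewGraph


namespace SkewGraph

variable {D E : Type*} {S : SkewGraph D E} {σ σ' τ τ' x y g h : D} {O X : Set E}
  {A K B LC c1 c2 c3 c4 a1 a2 b1 b2 g1 g2 k1 k2 : List D}

lemma append_mirror {l a b : List D} {d : D} (hl : l = a ++ d :: b) :
    S.mirror l = S.mirror b ++ S.ν d :: S.mirror a := by rw [hl]; simp

lemma Hub.pair_or_config (H : S.Hub X σ σ' τ τ' A K B LC) :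
    S.Pair σ σ' τ τ' {e | e ∈ S.toks LC ∧ e ∈ X} ∨
    (∃ c1 c2 c3 c4 a1 a2 b1 b2 g1 g2 k1 k2 x y g h,
      S.Config X σ σ' τ τ' A K B LC c1 c2 c3 c4 a1 a2 b1 b2 g1 g2 k1 k2 x y g h) ∨
    (∃ c1 c2 c3 c4 a1 a2 b1 b2 g1 g2 k1 k2 x y g h,
      S.Config X σ' σ τ τ' (S.mirror B) (S.mirror K) (S.mirror A) LC
        c1 c2 c3 c4 a1 a2 b1 b2 g1 g2 k1 k2 x y g h) := by
  have hm : ∃ e ∈ S.toks LC, e ∈ S.toks K := by have := H.meet; grind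
  obtain ⟨c1, x, c2, hCx, hxK, hc1⟩ := S.exists_first hm
  obtain ⟨c3, y, c4, hCy, hyK, hc4⟩ := S.exists_last hm
  obtain ⟨g1, g, g2, hg, hgC, hg1⟩ := S.exists_first H.meet
  obtain ⟨k1, h, k2, hh, hhC, hk2⟩ := S.exists_last H.meet
  have hLm : {e | e ∈ S.toks (S.mirror LC) ∧ e ∈ X} = {e | e ∈ S.toks LC ∧ e ∈ X} := by
    ext e
    simp only [mem_toks_mirror]
  have hc1' : ∀ e ∈ S.toks c1, e ∉ S.toks (S.mirror K) := by grind
  have hc4' : ∀ e ∈ S.toks (S.mirror c4), e ∉ S.toks K := by grind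
  have hc4'' : ∀ e ∈ S.toks (S.mirror c4), e ∉ S.toks (S.mirror K) := by grind
  have hk2' : ∀ e ∈ S.toks k2, e ∉ S.toks (S.mirror LC) := by grind
  have hg1' : ∀ e ∈ S.toks (S.mirror g1), e ∉ S.toks LC := by grind
  have hg1'' : ∀ e ∈ S.toks (S.mirror g1), e ∉ S.toks (S.mirror LC) := by grind
  have hgor : g ∈ LC ∨ S.ν g ∈ LC := by
    rcases S.exists_split_or hgC with ⟨a, b, rfl⟩ | ⟨a, b, rfl⟩ <;> simp
  have hhor : h ∈ LC ∨ S.ν h ∈ LC := by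
    rcases S.exists_split_or hhC with ⟨a, b, rfl⟩ | ⟨a, b, rfl⟩ <;> simp
  rcases S.exists_split_or hxK with ⟨a1, a2, hx⟩ | ⟨a1, a2, hx⟩
  · rcases hgor with hgL | hgL
    · refine .inl (H.mirror_left.pair_aux (h := S.ν g) hCx hc1' (append_mirror hx)
        (append_mirror hg)
        hg1' ?_).swap_left
      rwa [S.ν_ν]
    · rcases S.exists_split_or hyK with ⟨b1, b2, hy⟩ | ⟨b1, b2, hy⟩
      · rcases hhor with hhL | hhL
        · left
          have := (H.mirror_right.pair_aux (x := S.ν y) (h := h) (append_mirror hCy) hc4'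
            (by rwa [S.ν_ν]) hh hk2' (by simpa [S.ν_ν] using hhL)).swap_right
          rwa [hLm] at this
        · exact .inr (.inl ⟨c1, c2, c3, c4, a1, a2, b1, b2, g1, g2, k1, k2, x, y, g, h,
            H, hCx, hCy, hc1, hc4, hx, hy, hg, hh, hg1, hk2, hgL, hhL⟩)
      · left
        have := (H.mirror_left.mirror_right.pair_aux (x := S.ν y) (h := S.ν g) (append_mirror hCy)
          hc4'' (append_mirror hy) (append_mirror hg) hg1'' (by simpa [S.ν_ν] using hgL)).swap_right
        rw [hLm] at this
        exact this.swap_left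
  · rcases hhor with hhL | hhL
    · rcases S.exists_split_or hyK with ⟨b1, b2, hy⟩ | ⟨b1, b2, hy⟩
      · left
        have := (H.mirror_right.pair_aux (x := S.ν y) (h := h) (append_mirror hCy) hc4'
          (by rwa [S.ν_ν]) hh hk2' (by simpa [S.ν_ν] using hhL)).swap_right
        rwa [hLm] at this
      · rcases hgor with hgL | hgL
        · have hx' := S.append_mirror hx
          have hy' := S.append_mirror hy
          rw [S.ν_ν] at hx' hy'
          refine .inr (.inr ⟨c1, c2, c3, c4, _, _, _, _, _, _, _, _, x, y, S.ν h, S.ν g,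
            H.mirror_left, hCx, hCy, hc1', by grind, hx', hy', append_mirror hh, append_mirror hg,
            by grind, by grind, by rwa [S.ν_ν], by rwa [S.ν_ν]⟩)
        · left
          have := (H.mirror_left.mirror_right.pair_aux (x := S.ν y) (h := S.ν g) (append_mirror hCy)
            hc4'' (append_mirror hy) (append_mirror hg) hg1''
            (by simpa [S.ν_ν] using hgL)).swap_right
          rw [hLm] at this
          exact this.swap_left
    · exact .inl (H.pair_aux hCx hc1 hx hh hk2 hhL)

namespace Config

/-- The part of the path between the first and the last common token of `LC`. -/
lemma pair_zone
    (H : S.Config X σ σ' τ τ' A K B LC c1 c2 c3 c4 a1 a2 b1 b2 g1 g2 k1 k2 x y g h)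
    (hO : ∀ e, e = S.tok x ∨ e ∈ S.toks a2 → e = S.tok y ∨ e ∈ S.toks b1 → e ∈ O) :
    S.Pair σ σ' τ τ' O := by
  have hP := H.hub.path
  have hP' := H.hub.mirror_left.path
  have hC := H.hub.pathC
  have hC' := H.hub.mirror_right.pathC
  have hd := hP.distinct
  have hdC := hC.distinct
  rw [append_mirror H.hCx] at hC'
  rw [H.hCy] at hC
  rw [append_mirror H.hx] at hP'
  rw [H.hy] at hP
  have h1 := H.hc1
  have h4 := H.hc4
  have hA := H.hub.hA
  have hB := H.hub.hB
  have hx := H.hx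
  have hy := H.hy
  have hCx := H.hCx
  have hCy := H.hCy
  have hP2 : S.IsPath σ (S.ν σ') ((A ++ b1) ++ y :: (b2 ++ B)) := by simpa using hP
  have hP2' : S.IsPath σ' (S.ν σ)
      ((S.mirror B ++ S.mirror a2) ++ S.ν x :: (S.mirror a1 ++ S.mirror A)) := by simpa using hP'
  refine ⟨σ', σ, τ, τ', _, _, .inr rfl, .inl rfl, .inl rfl, .inr rfl,
    hP2'.splice hC' (by grind), hP2.splice hC (by grind), ?_⟩
  have h14 : ∀ e ∈ S.toks c1, e ∉ S.toks c4 := by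
    rcases split_cases (hCx.symm.trans hCy) with ⟨r, rfl, rfl⟩ | ⟨rfl, rfl, rfl⟩ | ⟨r, rfl, rfl⟩ <;>
      grind
  intro e he he'
  apply hO <;> grind

end Config

end SkewGraph


namespace SkewGraph

variable {D E : Type*} {S : SkewGraph D E} {σ σ' τ τ' x y g h t t' : D} {O X : Set E}
  {A K B P LC α β c1 c2 c3 c4 a1 a2 b1 b2 g1 g2 k1 k2 : List D}

lemma Pair.mono {O' : Set E} (hp : S.Pair σ σ' τ τ' O) (h : O ⊆ O') : S.Pair σ σ' τ τ' O' := by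
  obtain ⟨s, s', t, t', Z, Z', h1, h2, h3, h4, h5, h6, h7⟩ := hp
  exact ⟨s, s', t, t', Z, Z', h1, h2, h3, h4, h5, h6, fun e he he' => h (h7 e he he')⟩

lemma Config.pair_crossing
    (H : S.Config X σ σ' τ τ' [] P [] LC c1 c2 c3 c4 a1 a2 b1 b2 g1 g2 k1 k2 x y g h)
    (hβ : S.IsPath σ' t β) (hβX : ∀ e ∈ S.toks β, e ∈ X)
    (hαC : ∀ e ∈ S.toks α, e ∉ S.toks LC) (hβC : ∀ e ∈ S.toks β, e ∉ S.toks LC)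
    (hαβ : ∀ e ∈ S.toks α, e ∉ S.toks β) :
    S.Pair σ σ' τ τ' {e | e ∈ X ∧ e ∉ S.toks α} ∨
      S.Pair σ σ' τ τ' {e | e ∈ X ∧ e ∉ S.toks β} := by
  have hP : S.IsPath σ (S.ν σ') P := by simpa using H.hub.path
  have hP' : S.IsPath σ' (S.ν σ) (S.mirror P) := by simpa using H.hub.mirror_left.path
  have hd := hP.distinct
  have h1 := H.hc1
  have h4 := H.hc4
  have hx := H.hx
  have hy := H.hy
  have hg := H.hg
  have hh := H.hh
  have hCx := H.hCx
  have hCy := H.hCy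
  have hsub := H.hub.sub
  have hg1 := H.hg1
  have hk2 := H.hk2
  by_cases hz : ∃ e ∈ S.toks β, e ∈ {e | (e = S.tok x ∨ e ∈ S.toks a2) ∧
      (e = S.tok y ∨ e ∈ S.toks b1)}
  · left
    obtain ⟨β1, z, β2, rfl, ⟨hz1, hz2⟩, hβ1⟩ := S.exists_first hz
    have hβ1 : ∀ e ∈ S.toks β1, (e = S.tok x ∨ e ∈ S.toks a2) →
      (e = S.tok y ∨ e ∈ S.toks b1) → False := fun e h1 h2 h3 => hβ1 e h1 ⟨h2, h3⟩
    have hzK : S.tok z ∈ S.toks P := by grind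
    have hzC : S.tok z ∉ S.toks LC := by grind
    have hza : S.tok z ∈ S.toks a2 := by grind
    have hzb : S.tok z ∈ S.toks b1 := by grind
    rcases S.exists_split_or hzK with ⟨e1, e2, he⟩ | ⟨e1, e2, he⟩
    · obtain ⟨r, rfl, rfl⟩ : ∃ r, b1 = e1 ++ z :: r ∧ e2 = r ++ y :: b2 := by
        rcases split_cases (he.symm.trans hy) with h | ⟨h1, h2, h3⟩ | ⟨r, h1, h2⟩
        · exact h
        · grind
        · grind
      obtain ⟨r', rfl, rfl⟩ : ∃ r', e1 = a1 ++ x :: r' ∧ a2 = r' ++ z :: (r ++ y :: b2) := by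
        rcases split_cases (hx.symm.trans he) with h | ⟨h1, h2, h3⟩ | ⟨r, h1, h2⟩
        · exact h
        · grind
        · grind
      have hP2 : S.IsPath σ y ((a1 ++ x :: r') ++ z :: (r ++ [y])) := by
        rw [hy] at hP
        simpa using hP.take
      have hW := hβ.splice hP2 (by grind)
      have hW' : S.IsPath σ' y ((β1 ++ z :: r) ++ y :: []) := by simpa using hW
      have hU := hP
      rw [hg] at hU
      refine pair_last (.inr rfl) (.inl rfl) H.hub.pathC hCy hW' hU H.hνg (by grind) (by grind) hg1
          ?_
      have hrg : ∀ e ∈ S.toks r, e ∉ S.toks g1 := by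
        have hx' := hx.symm.trans hg
        rcases split_cases hx' with ⟨q, rfl, hq⟩ | ⟨rfl, hq⟩ | ⟨q, rfl, hq⟩ <;> grind
      intro e h5 h6
      refine ⟨?_, ?_⟩ <;> grind
    · obtain ⟨r, rfl, rfl⟩ : ∃ r, b1 = e1 ++ S.ν z :: r ∧ e2 = r ++ y :: b2 := by
        rcases split_cases (he.symm.trans hy) with h | ⟨h1, h2, h3⟩ | ⟨r, h1, h2⟩
        · exact h
        · grind
        · grind
      obtain ⟨r', rfl, rfl⟩ : ∃ r', e1 = a1 ++ x :: r' ∧ a2 = r' ++ S.ν z :: (r ++ y :: b2) := by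
        rcases split_cases (hx.symm.trans he) with h | ⟨h1, h2, h3⟩ | ⟨r, h1, h2⟩
        · exact h
        · grind
        · grind
      have hP2 : S.IsPath σ' (S.ν x)
          ((S.mirror b2 ++ S.ν y :: S.mirror r) ++ z :: (S.mirror r' ++ [S.ν x])) := by
        rw [append_mirror hx] at hP'
        simpa [S.ν_ν] using hP'.take
      have hW := hβ.splice hP2 (by grind)
      have hW' : S.IsPath σ' (S.ν x) ((β1 ++ z :: S.mirror r') ++ S.ν x :: []) := by simpa using hW
      have hU := hP'
      rw [append_mirror hh] at hU
      refine pair_first (.inr rfl) (.inr rfl) H.hub.pathC hCx hW' hU H.hνh (by grind) (by grind)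
        (by grind) ?_
      have hrg : ∀ e ∈ S.toks r', e ∉ S.toks k2 := by
        have hy' := hy.symm.trans hh
        rcases split_cases hy' with ⟨q, rfl, hq⟩ | ⟨hq, rfl, rfl⟩ | ⟨q, hq, rfl⟩ <;> grind
      intro e h5 h6
      refine ⟨?_, ?_⟩ <;> grind
  · right
    refine H.pair_zone fun e he he' => ⟨?_, fun h => hz ⟨e, h, he, he'⟩⟩
    grind

lemma Hub.pair_crossing (H : S.Hub X σ σ' τ τ' [] P [] LC)
    (hα : S.IsPath σ t α) (hβ : S.IsPath σ' t' β)
    (hαX : ∀ e ∈ S.toks α, e ∈ X) (hβX : ∀ e ∈ S.toks β, e ∈ X)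
    (hαC : ∀ e ∈ S.toks α, e ∉ S.toks LC) (hβC : ∀ e ∈ S.toks β, e ∉ S.toks LC)
    (hαβ : ∀ e ∈ S.toks α, e ∉ S.toks β) :
    S.Pair σ σ' τ τ' {e | e ∈ X ∧ e ∉ S.toks α} ∨
      S.Pair σ σ' τ τ' {e | e ∈ X ∧ e ∉ S.toks β} := by
  rcases H.pair_or_config with h |
    ⟨_, _, _, _, _, _, _, _, _, _, _, _, _, _, _, _, h⟩ |
    ⟨_, _, _, _, _, _, _, _, _, _, _, _, _, _, _, _, h⟩
  · exact .inl (h.mono fun e he => ⟨he.2, fun h' => hαC e h' he.1⟩)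
  · exact h.pair_crossing hβ hβX hαC hβC hαβ
  · rcases h.pair_crossing hα hαX hβC hαC (fun e h h' => hαβ e h' h) with h | h
    · exact .inr h.swap_left
    · exact .inl h.swap_left

end SkewGraph


namespace SkewGraph

variable {D E : Type*} {S : SkewGraph D E} {σ σ' τ τ' x y g h t t' p q : D} {O X : Set E} {n : ℕ}
  {A K B M P L LC α β c1 c2 c3 c4 a1 a2 b1 b2 g1 g2 k1 k2 : List D}

variable (S) in
/-- There is a path from `σ` back to `σ'` with tokens in `X` together with a pair of paths whose
common tokens lie in `X` and are avoided by the former path. -/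
def Goal (X : Set E) (σ σ' τ τ' : D) : Prop :=
  ∃ Q, S.IsPath σ (S.ν σ') Q ∧ (∀ e ∈ S.toks Q, e ∈ X) ∧
    S.Pair σ σ' τ τ' {e | e ∈ X ∧ e ∉ S.toks Q}

lemma Goal.swap_left (h : S.Goal X σ' σ τ τ') : S.Goal X σ σ' τ τ' := by
  obtain ⟨Q, h1, h2, h3⟩ := h
  refine ⟨S.mirror Q, by simpa [S.ν_ν] using h1.mirror, by grind, h3.swap_left.mono ?_⟩
  intro e he
  exact ⟨he.1, by simpa using he.2⟩

lemma Goal.swap_right (h : S.Goal X σ σ' τ' τ) : S.Goal X σ σ' τ τ' := by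
  obtain ⟨Q, h1, h2, h3⟩ := h
  exact ⟨Q, h1, h2, h3.swap_right⟩

variable (S) in
/-- A path `L = A ++ M ++ B` from `σ` back to `σ'` with tokens in `X` and avoiding `LC`, such that
every hub for `LC` sharing with `L` more than `n` entries leads to the desired conclusion. -/
structure Closed (X : Set E) (σ σ' τ τ' : D) (A M B LC : List D) (n : ℕ) : Prop where
  path : S.IsPath σ (S.ν σ') (A ++ M ++ B)
  sub : ∀ e ∈ S.toks (A ++ M ++ B), e ∈ X
  disj : ∀ e ∈ S.toks (A ++ M ++ B), e ∉ S.toks LC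
  ih : ∀ A' K' B' M', A ++ M ++ B = A' ++ M' ++ B' → K'.length < n →
    S.Hub X σ σ' τ τ' A' K' B' LC → S.Goal X σ σ' τ τ'

lemma Closed.mirror_left (H : S.Closed X σ σ' τ τ' A M B LC n) :
    S.Closed X σ' σ τ τ' (S.mirror B) (S.mirror M) (S.mirror A) LC n where
  path := by simpa [S.ν_ν] using H.path.mirror
  sub := by have := H.sub; grind
  disj := by have := H.disj; grind
  ih := by
    intro A' K' B' M' h1 h2 h3
    refine (H.ih (S.mirror B') (S.mirror K') (S.mirror A') (S.mirror M') ?_ (by simpa using h2)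
      h3.mirror_left).swap_left
    have := congrArg S.mirror h1
    simpa using this

lemma Closed.mirror_right (H : S.Closed X σ σ' τ τ' A M B LC n) :
    S.Closed X σ σ' τ' τ A M B (S.mirror LC) n where
  path := H.path
  sub := H.sub
  disj := by have := H.disj; grind
  ih := by
    intro A' K' B' M' h1 h2 h3
    have := h3.mirror_right
    rw [mirror_mirror] at this
    exact (H.ih A' K' B' M' h1 h2 this).swap_right

namespace Config

lemma goal_of_zone
    (H : S.Config X σ σ' τ τ' A K B LC c1 c2 c3 c4 a1 a2 b1 b2 g1 g2 k1 k2 x y g h)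
    (hL : S.IsPath σ (S.ν σ') L) (hX : ∀ e ∈ S.toks L, e ∈ X)
    (hz : ∀ e ∈ S.toks L, e = S.tok x ∨ e ∈ S.toks a2 → e = S.tok y ∨ e ∈ S.toks b1 → False) :
    S.Goal X σ σ' τ τ' := by
  refine ⟨L, hL, hX, H.pair_zone fun e h1 h2 => ⟨?_, fun h => hz e h h1 h2⟩⟩
  have := H.hub.sub
  have := H.hx
  grind

/-- The first entry of `M` meeting the part after `x`. -/
lemma goal_or_first
    (H : S.Config X σ σ' τ τ' A K B LC c1 c2 c3 c4 a1 a2 b1 b2 g1 g2 k1 k2 x y g h)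
    (HL : S.Closed X σ σ' τ τ' A M B LC K.length) (hM : ∃ e ∈ S.toks M, e ∈ S.toks a2) :
    S.Goal X σ σ' τ τ' ∨ ∃ M1 q M2 s1 s2, M = M1 ++ q :: M2 ∧ a2 = s1 ++ S.ν q :: s2 ∧
      (∀ e ∈ S.toks M1, e ∉ S.toks a2) ∧ ∀ e ∈ S.toks s2, e ∉ S.toks LC := by
  have hP := H.hub.path
  have hP' := H.hub.mirror_left.path
  have hd := hP.distinct
  have hL := HL.path
  have hdL := hL.distinct
  have hLX := HL.sub
  have hLC := HL.disj
  have hx := H.hx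
  have hy := H.hy
  have hh := H.hh
  have hCx := H.hCx
  have hCy := H.hCy
  have hsub := H.hub.sub
  have h1 := H.hc1
  obtain ⟨M1, q, M2, rfl, hq, hM1⟩ := S.exists_first hM
  have hL2 : S.IsPath σ (S.ν σ') ((A ++ M1) ++ q :: (M2 ++ B)) := by simpa using hL
  rcases S.exists_split_or hq with ⟨s1, s2, rfl⟩ | ⟨s1, s2, rfl⟩
  · left
    have hP2 : S.IsPath σ (S.ν σ') ((A ++ a1 ++ x :: s1) ++ q :: (s2 ++ B)) := by
      rw [hx] at hP; simpa using hP
    have hD := hL2.splice hP2 (by grind)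
    by_cases hs2 : ∃ e ∈ S.toks s2, e ∈ S.toks LC
    · refine HL.ih (A ++ M1 ++ [q]) s2 B M2 (by simp) (by rw [hx]; simp; omega) ?_
      constructor
      · simpa using hD
      · exact H.hub.pathC
      · grind
      · grind
      · grind
      · exact hs2
    · have hs : ∀ e ∈ S.toks s2, e ∉ S.toks LC := fun e h h' => hs2 ⟨e, h, h'⟩
      have hxC : S.tok x ∈ S.toks LC := by simp [hCx]
      have hyC : S.tok y ∈ S.toks LC := by simp [hCy]
      have hqC : S.tok q ∉ S.toks LC := hLC _ (by simp)
      have hb : ∀ e ∈ S.toks b1, e ≠ S.tok q ∧ e ∉ S.toks s2 := by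
        have hK : (a1 ++ x :: s1) ++ q :: s2 = b1 ++ y :: b2 := by simpa [hx] using hy
        have hdK : S.Distinct ((a1 ++ x :: s1) ++ q :: s2) := by
          rw [hK, ← hy]; grind
        rcases split_cases hK with ⟨r, -, rfl⟩ | ⟨-, rfl, -⟩ | ⟨r, hr, -⟩
        · exact absurd hyC (hs _ (by simp))
        · exact absurd hyC hqC
        · rw [hr] at hdK
          clear * - hdK
          grind
      have hbK : ∀ e ∈ S.toks b1, e ∈ S.toks K := by clear * - hy; grind
      refine H.goal_of_zone hD ?_ ?_
      · clear * - hLX hsub hx; grind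
      · clear * - hb hbK hs hxC hyC hqC hM1 hd hLC hx
        grind
  · by_cases hs2 : ∃ e ∈ S.toks s2, e ∈ S.toks LC
    · left
      refine ⟨_, hL, hLX, ?_⟩
      have hP2 : S.IsPath σ' (S.ν x)
          ((S.mirror B ++ S.mirror s2) ++ q :: (S.mirror s1 ++ [S.ν x])) := by
        rw [append_mirror hx] at hP'
        have : S.IsPath σ' (S.ν σ) ((S.mirror B ++ S.mirror s2 ++ q :: S.mirror s1) ++
          S.ν x :: (S.mirror a1 ++ S.mirror A)) := by simpa [S.ν_ν] using hP'
        simpa using this.take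
      have hW := hL2.splice hP2 (by grind)
      have hW' : S.IsPath σ (S.ν x) ((A ++ M1 ++ q :: S.mirror s1) ++ S.ν x :: []) := by
        simpa using hW
      have hU : S.IsPath σ' (S.ν σ)
          ((S.mirror B ++ S.mirror k2) ++ S.ν h :: (S.mirror k1 ++ S.mirror A)) := by
        rw [append_mirror hh] at hP'; simpa using hP'
      have hk2 := H.hk2
      have hB := H.hub.hB
      have hhC : S.tok h ∈ S.toks LC := by rw [← S.tok_ν]; exact S.tok_mem_toks H.hνh
      have hqC : S.tok q ∉ S.toks LC := hLC _ (by simp)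
      have hhc1 : S.tok h ∉ S.toks c1 := by clear * - hh h1; grind
      have hdK : S.Distinct K := by clear * - hd; grind
      have hks : ∀ e ∈ S.toks k2, e ∈ S.toks s2 := by
        have hx' : (a1 ++ x :: s1) ++ S.ν q :: s2 = k1 ++ h :: k2 := by simpa [hx] using hh
        obtain ⟨e, he, heC⟩ := hs2
        rcases split_cases hx' with ⟨w, -, rfl⟩ | ⟨-, rfl, -⟩ | ⟨w, hw, rfl⟩
        · clear * -; grind
        · rw [S.tok_ν] at hhC
          exact absurd hhC hqC
        · exact absurd heC (hk2 e (by clear * - he; grind))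
      refine pair_first (.inl rfl) (.inr rfl) H.hub.pathC hCx hW' hU H.hνh ?_ ?_ ?_ ?_
      · rwa [S.tok_ν]
      · rw [hCx] at hLC
        rw [hx] at h1
        clear * - hLC h1
        simp only [mem_toks_append, mem_toks_cons, mem_toks_mirror, tok_ν] at *
        grind
      · clear * - hk2 hB; grind
      · intro e h5 h6
        have hxC : S.tok x ∈ S.toks LC := by simp [hCx]
        simp only [mem_toks_append, mem_toks_cons, mem_toks_mirror] at h5 h6
        rw [hx] at hd hsub hdK
        clear * - hks hk2 hB hqC hxC hdL hLX hLC hd hsub h5 h6 hM1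
        simp only [distinct_append, distinct_cons, mem_toks_append, mem_toks_cons, tok_ν] at *
        refine ⟨?_, ?_⟩ <;> grind
    · right
      exact ⟨M1, q, M2, s1, s2, rfl, rfl, hM1, fun e h h' => hs2 ⟨e, h, h'⟩⟩

end Config

end SkewGraph


namespace SkewGraph

variable {D E : Type*} {S : SkewGraph D E} {σ σ' τ τ' x y g h t t' p q : D} {O X : Set E} {n : ℕ}
  {A K B M P L LC α β c1 c2 c3 c4 a1 a2 b1 b2 g1 g2 k1 k2 M1 M2 M3 r1 r2 r3 s2 : List D}

namespace Config

/-- The last entry of `M` meeting the part before `y`. -/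
lemma goal_or_last
    (H : S.Config X σ σ' τ τ' A K B LC c1 c2 c3 c4 a1 a2 b1 b2 g1 g2 k1 k2 x y g h)
    (HL : S.Closed X σ σ' τ τ' A M B LC K.length) (hM : ∃ e ∈ S.toks M, e ∈ S.toks b1) :
    S.Goal X σ σ' τ τ' ∨ ∃ M1 p M2 s1 s2, M = M1 ++ p :: M2 ∧ b1 = s1 ++ S.ν p :: s2 ∧
      (∀ e ∈ S.toks M2, e ∉ S.toks b1) ∧ ∀ e ∈ S.toks s1, e ∉ S.toks LC := by
  have HL' := HL.mirror_left.mirror_right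
  rw [← length_mirror] at HL'
  rcases H.mirror.goal_or_first HL' (by simpa using hM) with h | ⟨M1, q, M2, s1, s2, h1, h2, h3, h4⟩
  · exact .inl h.swap_left.swap_right
  · right
    have h1' := S.append_mirror h1
    have h2' := S.append_mirror h2
    rw [mirror_mirror] at h1' h2'
    refine ⟨S.mirror M2, S.ν q, S.mirror M1, S.mirror s2, S.mirror s1, h1', h2', ?_, ?_⟩
    · simpa using h3
    · simpa using h4

/-- The case in which the part of `M` before `q` meets the part between `p` and `x`. -/
lemma goal_of_meet
    (H : S.Config X σ σ' τ τ' A K B LC c1 c2 c3 c4 (r1 ++ S.ν p :: r2) (r3 ++ S.ν q :: s2)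
      b1 b2 g1 g2 k1 k2 x y g h)
    (HL : S.Closed X σ σ' τ τ' A (M1 ++ q :: (M2 ++ p :: M3)) B LC K.length)
    (hM1 : ∀ e ∈ S.toks M1, e ∉ S.toks (r3 ++ S.ν q :: s2))
    (hM3 : ∀ e ∈ S.toks M3, e ∉ S.toks b1)
    (hb : ∃ r, b1 = (r1 ++ S.ν p :: r2) ++ x :: r)
    (hr : ∃ e ∈ S.toks M1, e ∈ S.toks r2) : S.Goal X σ σ' τ τ' := by
  have hP := H.hub.path
  have hP' := H.hub.mirror_left.path
  have hd := hP.distinct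
  have hL := HL.path
  have hdL := hL.distinct
  have hLX := HL.sub
  have hLC := HL.disj
  have hx := H.hx
  have hCx : S.tok x ∈ S.toks LC := by simp [H.hCx]
  have hCy : S.tok y ∈ S.toks LC := by simp [H.hCy]
  have hsub := H.hub.sub
  obtain ⟨rb, rfl⟩ := hb
  obtain ⟨m1, r, m2, rfl, hr, hm1⟩ := S.exists_first hr
  rw [hx] at hd hsub
  have hL2 : S.IsPath σ (S.ν σ') ((A ++ m1) ++ r :: (m2 ++ q :: (M2 ++ p :: M3) ++ B)) := by
    simpa using hL
  rcases S.exists_split_or hr with ⟨s1, s2', rfl⟩ | ⟨s1, s2', rfl⟩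
  · have hP2 : S.IsPath σ (S.ν σ') ((A ++ r1 ++ S.ν p :: s1) ++ r ::
        (s2' ++ x :: (r3 ++ S.ν q :: s2) ++ B)) := by
      rw [hx] at hP; simpa using hP
    have hD := hL2.splice hP2 <| by
      clear * - hdL hd hm1 hM1 hLC hCx
      simp only [distinct_append, distinct_cons, mem_toks_append, mem_toks_cons, tok_ν] at *
      grind
    refine HL.ih (A ++ m1 ++ [r]) (s2' ++ x :: (r3 ++ S.ν q :: s2)) B (m2 ++ q :: (M2 ++ p :: M3))
      (by simp) (by rw [hx]; simp; omega) ?_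
    constructor
    · simpa using hD
    · exact H.hub.pathC
    · clear * - hsub
      simp only [mem_toks_append, mem_toks_cons, tok_ν] at *
      grind
    · clear * - hLC
      simp only [mem_toks_append, mem_toks_cons, mem_toks_nil] at *
      grind
    · exact H.hub.hB
    · exact ⟨_, by simp, hCx⟩
  · have hP2 : S.IsPath σ' p ((S.mirror B ++ S.mirror (r3 ++ S.ν q :: s2) ++ S.ν x :: S.mirror s2')
        ++ r :: (S.mirror s1 ++ [p])) := by
      have : S.IsPath σ' (S.ν σ) ((S.mirror B ++ S.mirror (r3 ++ S.ν q :: s2) ++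
          S.ν x :: S.mirror s2' ++ r :: S.mirror s1) ++ p :: (S.mirror r1 ++ S.mirror A)) := by
        rw [hx] at hP'; simpa [S.ν_ν] using hP'
      simpa using this.take
    have hW := hL2.splice hP2 <| by
      clear * - hdL hd hm1
      simp only [distinct_append, distinct_cons, mem_toks_append, mem_toks_cons, mem_toks_mirror,
        tok_ν, mem_toks_nil] at *
      grind
    have hW' : S.IsPath σ p ((A ++ m1 ++ r :: S.mirror s1) ++ p :: []) := by simpa using hW
    have hL3 : S.IsPath σ (S.ν σ') ((A ++ m1 ++ r :: m2 ++ q :: M2) ++ p :: (M3 ++ B)) := by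
      simpa using hL
    have hD := hW'.splice hL3 <| by
      clear * - hdL hd hm1 hM3
      simp only [distinct_append, distinct_cons, mem_toks_append, mem_toks_cons, mem_toks_mirror,
        tok_ν] at *
      grind
    refine H.goal_of_zone hD ?_ ?_
    · clear * - hLX hsub
      simp only [mem_toks_append, mem_toks_cons, mem_toks_mirror, tok_ν] at *
      grind
    · clear * - hd hdL hm1 hM1 hM3 hLC hCx hCy
      simp only [distinct_append, distinct_cons, mem_toks_append, mem_toks_cons, mem_toks_mirror,
        tok_ν] at *
      rintro e he (h1 | h1) h2
      · grind
      · rcases he with ((he | he) | he | he) | he | he | he <;> grind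

end Config

end SkewGraph


namespace SkewGraph

variable {D E : Type*} {S : SkewGraph D E} {σ σ' τ τ' x y g h p q : D} {X : Set E} {n : ℕ}
  {A K B M L LC c1 c2 c3 c4 a1 a2 b1 b2 g1 g2 k1 k2 M1 M2 M3 r1 r2 r3 s2 : List D}

namespace Config

lemma goal_of_split
    (H : S.Config X σ σ' τ τ' A K B LC c1 c2 c3 c4 (r1 ++ S.ν p :: r2)
      (r3 ++ y :: (b2 ++ S.ν q :: s2)) (r1 ++ S.ν p :: r2 ++ x :: r3) (b2 ++ S.ν q :: s2)
      g1 g2 k1 k2 x y g h)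
    (HL : S.Closed X σ σ' τ τ' A (M1 ++ q :: (M2 ++ p :: M3)) B LC K.length)
    (hM1 : ∀ e ∈ S.toks M1, e ∉ S.toks (r3 ++ y :: (b2 ++ S.ν q :: s2)))
    (hM3 : ∀ e ∈ S.toks M3, e ∉ S.toks (r1 ++ S.ν p :: r2 ++ x :: r3)) :
    S.Goal X σ σ' τ τ' := by
  by_cases h1 : ∃ e ∈ S.toks M1, e ∈ S.toks r2
  · have hz : r3 ++ y :: (b2 ++ S.ν q :: s2) = (r3 ++ y :: b2) ++ S.ν q :: s2 := by simp
    rw [hz] at H hM1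
    exact H.goal_of_meet HL hM1 hM3 ⟨_, rfl⟩ h1
  by_cases h3 : ∃ e ∈ S.toks M3, e ∈ S.toks b2
  · have H' := H.mirror
    have HL' := HL.mirror_left.mirror_right
    rw [← length_mirror] at HL'
    have e1 : S.mirror (b2 ++ S.ν q :: s2) = S.mirror s2 ++ S.ν (S.ν q) :: S.mirror b2 := by simp
    have e2 : S.mirror (r1 ++ S.ν p :: r2 ++ x :: r3) =
      (S.mirror r3 ++ S.ν x :: S.mirror r2) ++ S.ν (S.ν p) :: S.mirror r1 := by simp
    have e3 : S.mirror (M1 ++ q :: (M2 ++ p :: M3)) =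
      S.mirror M3 ++ S.ν p :: (S.mirror M2 ++ S.ν q :: S.mirror M1) := by simp
    rw [e1, e2] at H'
    rw [e3] at HL'
    refine (H'.goal_of_meet HL' ?_ ?_ ⟨S.mirror r3, ?_⟩ ?_).swap_left.swap_right
    · rw [← e2]
      simpa only [mem_toks_mirror] using hM3
    · simpa only [mem_toks_mirror] using hM1
    · simp
    · simpa only [mem_toks_mirror] using h3
  have h1 : ∀ e ∈ S.toks M1, e ∉ S.toks r2 := fun e h h' => h1 ⟨e, h, h'⟩
  have h3 : ∀ e ∈ S.toks M3, e ∉ S.toks b2 := fun e h h' => h3 ⟨e, h, h'⟩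
  have hP := H.hub.path
  have hP' := H.hub.mirror_left.path
  have hd := hP.distinct
  have hL := HL.path
  have hdL := hL.distinct
  have hLX := HL.sub
  have hLC := HL.disj
  have hx := H.hx
  have hCx : S.tok x ∈ S.toks LC := by simp [H.hCx]
  have hCy : S.tok y ∈ S.toks LC := by simp [H.hCy]
  have hsub := H.hub.sub
  rw [hx] at hd hsub
  have hL2 : S.IsPath σ (S.ν σ') ((A ++ M1) ++ q :: (M2 ++ p :: M3 ++ B)) := by
    simpa using hL
  have hP2 : S.IsPath σ' p ((S.mirror B ++ S.mirror s2) ++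
      q :: (S.mirror (r2 ++ x :: (r3 ++ y :: b2)) ++ [p])) := by
    have : S.IsPath σ' (S.ν σ) ((S.mirror B ++ S.mirror s2 ++
        q :: S.mirror (r2 ++ x :: (r3 ++ y :: b2))) ++ p :: (S.mirror r1 ++ S.mirror A)) := by
      rw [hx] at hP'; simpa [S.ν_ν] using hP'
    simpa using this.take
  have hW := hL2.splice hP2 <| by
    clear * - hdL hd hM1 h1 hLC hCx
    simp only [distinct_append, distinct_cons, mem_toks_append, mem_toks_cons, tok_ν,
      mem_toks_mirror, mem_toks_nil] at *
    rintro e (he | he) <;> grind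
  have hW' : S.IsPath σ p ((A ++ M1 ++ q :: S.mirror (r2 ++ x :: (r3 ++ y :: b2))) ++ p :: []) := by
    simpa using hW
  have hL3 : S.IsPath σ (S.ν σ') ((A ++ M1 ++ q :: M2) ++ p :: (M3 ++ B)) := by
    simpa using hL
  have hD := hW'.splice hL3 <| by
    clear * - hdL hd hM3 h3 hLC hCy
    simp only [distinct_append, distinct_cons, mem_toks_append, mem_toks_cons, tok_ν,
      mem_toks_mirror] at *
    rintro e ((he | he) | he | he | he | he | he | he) <;> grind
  refine HL.ih (A ++ M1 ++ [q]) (S.mirror (r2 ++ x :: (r3 ++ y :: b2))) (p :: (M3 ++ B)) M2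
    (by simp) (by rw [hx]; simp; omega) ?_
  constructor
  · simpa using hD
  · exact H.hub.pathC
  · clear * - hsub
    simp only [mem_toks_append, mem_toks_cons, tok_ν, mem_toks_mirror] at *
    grind
  · clear * - hLC
    simp only [mem_toks_append, mem_toks_cons, mem_toks_nil] at *
    grind
  · clear * - hLC
    simp only [mem_toks_append, mem_toks_cons] at *
    grind
  · exact ⟨S.tok x, by simp [S.tok_ν], hCx⟩

lemma goal (H : S.Config X σ σ' τ τ' A K B LC c1 c2 c3 c4 a1 a2 b1 b2 g1 g2 k1 k2 x y g h)
    (HL : S.Closed X σ σ' τ τ' A M B LC K.length) : S.Goal X σ σ' τ τ' := by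
  have hd := H.hub.path.distinct
  have hdL := HL.path.distinct
  have hLC := HL.disj
  have hx := H.hx
  have hy := H.hy
  have hCx : S.tok x ∈ S.toks LC := by simp [H.hCx]
  have hCy : S.tok y ∈ S.toks LC := by simp [H.hCy]
  by_cases hz : ∃ e ∈ S.toks M, e ∈ S.toks a2 ∧ e ∈ S.toks b1
  · obtain ⟨e, heM, hea, heb⟩ := hz
    obtain ⟨r, rfl, rfl⟩ : ∃ r, b1 = a1 ++ x :: r ∧ a2 = r ++ y :: b2 := by
      rw [hx] at hd
      rcases split_cases (hx.symm.trans hy) with h | ⟨rfl, rfl, rfl⟩ | ⟨r, rfl, rfl⟩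
      · exact h
      all_goals
        exfalso
        clear * - hd hea heb
        simp only [distinct_append, distinct_cons, mem_toks_append, mem_toks_cons] at hd hea
        grind
    rcases H.goal_or_first HL ⟨e, heM, hea⟩ with hG | ⟨M1, q, M2, s1, s2, hM, hs, hM1, hs2⟩
    · exact hG
    rcases H.goal_or_last HL ⟨e, heM, heb⟩ with hG | ⟨N1, p, N2, r1, r2, hN, hr, hN2, hr1⟩
    · exact hG
    have hqC : S.tok q ∉ S.toks LC := hLC _ (by simp [hM])
    have hpC : S.tok p ∉ S.toks LC := hLC _ (by simp [hN])
    obtain ⟨b2', rfl, rfl⟩ : ∃ b, s1 = r ++ y :: b ∧ b2 = b ++ S.ν q :: s2 := by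
      rcases split_cases hs with h | ⟨-, rfl, -⟩ | ⟨w, -, rfl⟩
      · exact h
      · rw [S.tok_ν] at hCy
        exact absurd hCy hqC
      · exact absurd hCy (hs2 _ (by simp))
    obtain ⟨a1', rfl, rfl⟩ : ∃ a, a1 = r1 ++ S.ν p :: a ∧ r2 = a ++ x :: r := by
      rcases split_cases hr with ⟨w, rfl, -⟩ | ⟨-, rfl, -⟩ | h
      · exact absurd hCx (hr1 _ (by simp))
      · rw [S.tok_ν] at hCx
        exact absurd hCx hpC
      · exact h
    subst hM
    rcases split_cases hN with ⟨w, rfl, rfl⟩ | ⟨rfl, rfl, rfl⟩ | ⟨w, rfl, rfl⟩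
    · exact H.goal_of_split HL hM1 hN2
    · exfalso
      rw [hx] at hd
      clear * - hd
      simp only [distinct_append, distinct_cons, mem_toks_append, mem_toks_cons, tok_ν] at *
      grind
    · exfalso
      clear hd hdL hLC hx hy H HL hN
      simp only [mem_toks_append, mem_toks_cons, tok_ν] at *
      grind
  · refine H.goal_of_zone HL.path HL.sub ?_
    intro e he h1 h2
    have heC := hLC e he
    refine hz ⟨e, ?_, ?_, ?_⟩ <;> clear H HL <;> grind

end Config

/-- A path from `σ` back to `σ'` avoiding a path `LC` from `τ` back to `τ'` that meets another
path from `σ` back to `σ'` yields the desired triple of paths. -/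
theorem Hub.goal {σ σ' τ τ' : D} {A K B M LC : List D} (H : S.Hub X σ σ' τ τ' A K B LC)
    (path : S.IsPath σ (S.ν σ') (A ++ M ++ B))
    (sub : ∀ e ∈ S.toks (A ++ M ++ B), e ∈ X)
    (disj : ∀ e ∈ S.toks (A ++ M ++ B), e ∉ S.toks LC) : S.Goal X σ σ' τ τ' := by
  induction hn : K.length using Nat.strong_induction_on generalizing A K B M with
  | _ n ih =>
    subst hn
    have HL : S.Closed X σ σ' τ τ' A M B LC K.length := by
      refine ⟨path, sub, disj, fun A' K' B' M' h1 h2 h3 => ?_⟩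
      rw [h1] at path sub disj
      exact ih _ h2 h3 path sub disj rfl
    rcases H.pair_or_config with h |
      ⟨_, _, _, _, _, _, _, _, _, _, _, _, _, _, _, _, h⟩ |
      ⟨_, _, _, _, _, _, _, _, _, _, _, _, _, _, _, _, h⟩
    · exact ⟨_, path, sub, h.mono fun e he => ⟨he.2, fun h' => disj e h' he.1⟩⟩
    · exact h.goal HL
    · have HL' := HL.mirror_left
      rw [← S.length_mirror] at HL'
      exact (h.goal HL').swap_left

end SkewGraph

namespace Multigraph

variable {V E : Type*}

/-- The edges of `N` with an orientation. -/
@[ext] structure Dart (G : Multigraph V E) (N : Set E) where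
  tail : V
  head : V
  edge : E
  edge_mem : edge ∈ N
  inc_eq : G.inc edge = s(tail, head)

variable {G : Multigraph V E} {N X : Set E} {e0 : E} {u1 u2 : V}

/-- The reversed dart. -/
def Dart.rev (d : G.Dart N) : G.Dart N :=
  ⟨d.head, d.tail, d.edge, d.edge_mem, by rw [d.inc_eq, Sym2.eq_swap]⟩

lemma Dart.tail_ne_head (d : G.Dart N) : d.tail ≠ d.head := by
  intro h
  have := G.no_loops d.edge
  rw [d.inc_eq, h] at this
  simp at this

lemma Dart.mem_inc (d : G.Dart N) {v : V} : v ∈ G.inc d.edge ↔ v = d.tail ∨ v = d.head := by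
  rw [d.inc_eq, Sym2.mem_iff]

/-- The darts of `N`, where an arc from `d` to `d'` is an edge of `H` from the head of `d` to the
tail of `d'`. -/
def darts (G : Multigraph V E) (N H : Set E) : SkewGraph (G.Dart N) E where
  ν := Dart.rev
  tok := Dart.edge
  R d d' := ∃ g ∈ H, G.inc g = s(d.head, d'.tail)
  ν_ν _ := rfl
  tok_ν _ := rfl
  eq_or_eq_ν a b h := by
    have h' := a.inc_eq
    rw [h, b.inc_eq, Sym2.eq_iff] at h'
    rcases h' with h' | h'
    · exact .inl (Dart.ext h'.1.symm h'.2.symm h)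
    · exact .inr (Dart.ext h'.1.symm h'.2.symm h)
  R_ν a b := by
    rintro ⟨g, hg, h⟩
    exact ⟨g, hg, by rw [h, Sym2.eq_swap]; rfl⟩

/-- The edge set `N` covers each vertex once, except for the ends `u1`, `u2` of the edge `e0`;
those have degree three and are covered twice, by the edges of the darts `τ`, `τ'` and `σ`, `σ'`
respectively. -/
structure Frame (e0 : E) (u1 u2 : V) (σ σ' τ τ' : G.Dart N) : Prop where
  inc_e0 : G.inc e0 = s(u1, u2)
  e0_notMem : e0 ∉ N
  unique : ∀ v, v ≠ u1 → v ≠ u2 → ∃! e, e ∈ N ∧ v ∈ G.inc e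
  notMem_inc₁ : ∀ g, g ∉ N → g ≠ e0 → u1 ∉ G.inc g
  notMem_inc₂ : ∀ g, g ∉ N → g ≠ e0 → u2 ∉ G.inc g
  tail_σ : σ.tail = u2
  tail_σ' : σ'.tail = u2
  head_τ : τ.head = u1
  head_τ' : τ'.head = u1
  σ_ne : σ.edge ≠ σ'.edge
  τ_ne : τ.edge ≠ τ'.edge
  eq_σ : ∀ e ∈ N, u2 ∈ G.inc e → e = σ.edge ∨ e = σ'.edge
  eq_τ : ∀ e ∈ N, u1 ∈ G.inc e → e = τ.edge ∨ e = τ'.edge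

/-- The darts of `N`, joined by the edges outside `N` and different from `e0`. -/
abbrev alt (G : Multigraph V E) (N : Set E) (e0 : E) : SkewGraph (G.Dart N) E :=
  G.darts N {g | g ∉ N ∧ g ≠ e0}

namespace Frame

variable {σ σ' τ τ' s t d d' : G.Dart N} {P L L' Z Z' L1 LC L4 D : List (G.Dart N)} {v : V}
  {e f : E}

lemma symm (F : Frame e0 u1 u2 σ σ' τ τ') : Frame e0 u2 u1 τ.rev τ'.rev σ.rev σ'.rev where
  inc_e0 := by rw [F.inc_e0, Sym2.eq_swap]
  e0_notMem := F.e0_notMem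
  unique v h h' := F.unique v h' h
  notMem_inc₁ := F.notMem_inc₂
  notMem_inc₂ := F.notMem_inc₁
  tail_σ := F.head_τ
  tail_σ' := F.head_τ'
  head_τ := F.tail_σ
  head_τ' := F.tail_σ'
  σ_ne := F.τ_ne
  τ_ne := F.σ_ne
  eq_σ := F.eq_τ
  eq_τ := F.eq_σ

lemma ne (F : Frame e0 u1 u2 σ σ' τ τ') : u1 ≠ u2 := by
  intro h
  have := G.no_loops e0
  rw [F.inc_e0, h] at this
  simp at this

lemma edge_eq (F : Frame e0 u1 u2 σ σ' τ τ') (h1 : v ≠ u1) (h2 : v ≠ u2) (he : e ∈ N)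
    (hf : f ∈ N) (hve : v ∈ G.inc e) (hvf : v ∈ G.inc f) : e = f :=
  (F.unique v h1 h2).unique ⟨he, hve⟩ ⟨hf, hvf⟩

lemma ne_of_step (F : Frame e0 u1 u2 σ σ' τ τ') {g : E} (hg : g ∉ N ∧ g ≠ e0)
    (hv : v ∈ G.inc g) : v ≠ u1 ∧ v ≠ u2 :=
  ⟨fun h => F.notMem_inc₁ g hg.1 hg.2 (h ▸ hv), fun h => F.notMem_inc₂ g hg.1 hg.2 (h ▸ hv)⟩

/-- The edges of the arcs of a path ending at a root cover exactly the vertices of the path that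
are not roots, except for its first vertex. -/
lemma exists_steps (F : Frame e0 u1 u2 σ σ' τ τ') (hc : (d :: L).IsChain (G.alt N e0).R)
    (hd : (G.alt N e0).Distinct (d :: L)) (hl : (d :: L).getLast? = some t)
    (ht : t.head = u1 ∨ t.head = u2) :
    ∃ T : Set E, (∀ g ∈ T, g ∉ N ∧ g ≠ e0) ∧
      (∀ g ∈ T, ∀ v ∈ G.inc g, ∃ e ∈ (G.alt N e0).toks (d :: L), v ∈ G.inc e) ∧
      (∀ g ∈ T, d.tail ∉ G.inc g) ∧
      ∀ e ∈ (G.alt N e0).toks (d :: L), ∀ v ∈ G.inc e, v ≠ d.tail → v ≠ u1 → v ≠ u2 →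
        ∃! g, g ∈ T ∧ v ∈ G.inc g := by
  induction L generalizing d with
  | nil =>
    refine ⟨∅, by simp, by simp, by simp, ?_⟩
    intro e he v hv h1 h2 h3
    obtain rfl : d = t := by simpa using hl
    obtain rfl : e = d.edge := by simpa [alt, darts] using he
    rw [d.mem_inc] at hv
    grind
  | cons d' L ih =>
    obtain ⟨T, hT, hTv, hTd, hTu⟩ := ih (List.isChain_cons_cons.1 hc).2
      ((SkewGraph.distinct_cons _ _ _).1 hd).2 (by simpa using hl)
    obtain ⟨g, hg, hgi⟩ := (List.isChain_cons_cons.1 hc).1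
    have hdN : ∀ e ∈ (G.alt N e0).toks (d' :: L), d.edge ≠ e := by
      rw [SkewGraph.distinct_cons] at hd
      rintro e he rfl
      exact hd.1 he
    have hN : ∀ e ∈ (G.alt N e0).toks (d' :: L), e ∈ N := by
      rintro e ⟨x, -, rfl⟩
      exact x.edge_mem
    have hh : d.head ≠ u1 ∧ d.head ≠ u2 := F.ne_of_step hg (by simp [hgi])
    have ht' : d'.tail ≠ u1 ∧ d'.tail ≠ u2 := F.ne_of_step hg (by simp [hgi])
    have hsep : ∀ v, v ≠ u1 → v ≠ u2 → v ∈ G.inc d.edge →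
        ∀ e ∈ (G.alt N e0).toks (d' :: L), v ∉ G.inc e := fun v h1 h2 h e he h' =>
      hdN e he (F.edge_eq h1 h2 d.edge_mem (hN e he) h h')
    have hgm : ∀ v, v ∈ G.inc g ↔ v = d.head ∨ v = d'.tail := by simp [hgi]
    have hd' : d'.edge ∈ (G.alt N e0).toks (d' :: L) := by simp [darts]
    have htok : ∀ e, e ∈ (G.alt N e0).toks (d :: d' :: L) ↔
      e = d.edge ∨ e ∈ (G.alt N e0).toks (d' :: L) := fun e => SkewGraph.mem_toks_cons _ _ _ _
    refine ⟨insert g T, ?_, ?_, ?_, ?_⟩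
    · rintro g' (rfl | h)
      exacts [hg, hT _ h]
    · rintro g' (rfl | h) v hv
      · rcases (hgm v).1 hv with rfl | rfl
        · exact ⟨d.edge, by simp [htok], by simp [d.mem_inc]⟩
        · exact ⟨d'.edge, by simp [htok, hd'], by simp [d'.mem_inc]⟩
      · obtain ⟨e, he, hve⟩ := hTv g' h v hv
        exact ⟨e, by simp only [htok]; exact .inr he, hve⟩
    · rintro g' (rfl | h) hv
      · rcases (hgm _).1 hv with h | h
        · exact d.tail_ne_head h
        · exact hsep _ (h ▸ ht'.1) (h ▸ ht'.2) (by simp [d.mem_inc]) _ hd'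
            (by simp [d'.mem_inc, h])
      · obtain ⟨e, he, hve⟩ := hTv g' h _ hv
        have := F.ne_of_step (hT _ h) hv
        exact hsep _ this.1 this.2 (by simp [d.mem_inc]) e he hve
    · intro e he v hv h1 h2 h3
      rcases (htok e).1 he with rfl | he
      · obtain rfl : v = d.head := by
          have := d.mem_inc.1 hv
          tauto
        refine ⟨g, ⟨by simp, by simp [hgi]⟩, ?_⟩
        rintro g' ⟨rfl | h, hg'⟩
        · rfl
        · obtain ⟨e, he, hve⟩ := hTv g' h _ hg'
          exact absurd hve (hsep _ h2 h3 hv e he)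
      · by_cases hvt : v = d'.tail
        · subst hvt
          refine ⟨g, ⟨by simp, by simp [hgi]⟩, ?_⟩
          rintro g' ⟨rfl | h, hg'⟩
          · rfl
          · exact absurd hg' (hTd _ h)
        · obtain ⟨g', ⟨h, hv'⟩, hu⟩ := hTu e he v hv hvt h2 h3
          refine ⟨g', ⟨.inr h, hv'⟩, ?_⟩
          rintro g'' ⟨rfl | h, hg'⟩
          · rcases (hgm v).1 hg' with rfl | h
            · exact absurd hv (hsep _ h2 h3 (by simp [d.mem_inc]) e he)
            · exact absurd h hvt
          · exact hu _ ⟨h, hg'⟩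

end Frame

end Multigraph

namespace SkewGraph

variable {D E : Type*} {S : SkewGraph D E}

lemma eq_head_or_exists {l : List D} {d : D} (hc : l.IsChain S.R) (hd : d ∈ l) :
    l.head? = some d ∨ ∃ y ∈ l, S.R y d := by
  obtain ⟨a, b, rfl⟩ := List.append_of_mem hd
  rcases a.eq_nil_or_concat with rfl | ⟨a, y, rfl⟩
  · simp
  · right
    refine ⟨y, by simp, ?_⟩
    have : (a ++ y :: d :: b).IsChain S.R := by simpa using hc
    exact (List.isChain_cons_cons.1 (List.isChain_append.1 this).2.1).1

lemma eq_last_or_exists {l : List D} {d : D} (hc : l.IsChain S.R) (hd : d ∈ l) :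
    l.getLast? = some d ∨ ∃ y ∈ l, S.R d y := by
  obtain ⟨a, b, rfl⟩ := List.append_of_mem hd
  cases b with
  | nil => simp
  | cons y b =>
    right
    exact ⟨y, by simp, (List.isChain_cons_cons.1 (List.isChain_append.1 hc).2.1).1⟩

end SkewGraph

namespace Multigraph

variable {V E : Type*} {G : Multigraph V E} {N X : Set E} {e0 : E} {u1 u2 : V}

namespace Frame

variable {σ σ' τ τ' s t d d' : G.Dart N} {P L L' Z Z' L1 LC L4 D : List (G.Dart N)} {v : V}
  {e f : E}

lemma edge_of_root (F : Frame e0 u1 u2 σ σ' τ τ') (hZ : (G.alt N e0).IsPath s t Z)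
    (he : e ∈ (G.alt N e0).toks Z) (hv : v ∈ G.inc e) (hr : v = u1 ∨ v = u2) :
    (e = s.edge ∧ v = s.tail) ∨ (e = t.edge ∧ v = t.head) := by
  obtain ⟨x, hx, rfl⟩ := he
  rcases x.mem_inc.1 hv with rfl | rfl
  · rcases SkewGraph.eq_head_or_exists hZ.chain hx with h | ⟨y, -, g, hg, hgi⟩
    · rw [hZ.head, Option.some_inj] at h
      exact .inl ⟨by rw [h]; rfl, by rw [h]⟩
    · have := F.ne_of_step (v := x.tail) hg (by simp [hgi])
      tauto
  · rcases SkewGraph.eq_last_or_exists hZ.chain hx with h | ⟨y, -, g, hg, hgi⟩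
    · rw [hZ.last, Option.some_inj] at h
      exact .inr ⟨by rw [h]; rfl, by rw [h]⟩
    · have := F.ne_of_step (v := x.head) hg (by simp [hgi])
      tauto

lemma exists_matching (F : Frame e0 u1 u2 σ σ' τ τ') (hZ : (G.alt N e0).IsPath s t Z)
    (hs : s.tail = u1 ∨ s.tail = u2) (ht : t.head = u1 ∨ t.head = u2) :
    ∃ T : Set E, (∀ g ∈ T, g ∉ N ∧ g ≠ e0) ∧
      (∀ g ∈ T, ∀ v ∈ G.inc g, ∃ e ∈ (G.alt N e0).toks Z, v ∈ G.inc e) ∧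
      ∀ e ∈ (G.alt N e0).toks Z, ∀ v ∈ G.inc e, v ≠ u1 → v ≠ u2 → ∃! g, g ∈ T ∧ v ∈ G.inc g := by
  cases Z with
  | nil => simpa using hZ.head
  | cons d L =>
    obtain rfl : d = s := by simpa using hZ.head
    obtain ⟨T, h1, h2, -, h3⟩ := F.exists_steps hZ.chain hZ.distinct hZ.last ht
    refine ⟨T, h1, h2, fun e he v hv hv1 hv2 => h3 e he v hv ?_ hv1 hv2⟩
    rintro rfl
    tauto

lemma toks_subset (l : List (G.Dart N)) : (G.alt N e0).toks l ⊆ N := by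
  rintro e ⟨x, -, rfl⟩
  exact x.edge_mem

lemma start_mem (hZ : (G.alt N e0).IsPath s t Z) : s.edge ∈ (G.alt N e0).toks Z :=
  SkewGraph.tok_mem_toks _ (List.mem_of_mem_head? hZ.head)

lemma end_mem (hZ : (G.alt N e0).IsPath s t Z) : t.edge ∈ (G.alt N e0).toks Z :=
  SkewGraph.tok_mem_toks _ (List.mem_of_mem_getLast? hZ.last)

/-- Exchanging along an alternating path from `u2` to `u1` yields a perfect matching. -/
lemma exists_isPM_of_path (F : Frame e0 u1 u2 σ σ' τ τ') (hZ : (G.alt N e0).IsPath s t Z)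
    (hs : s = σ ∨ s = σ') (ht : t = τ ∨ t = τ') :
    ∃ P, G.IsPM P ∧ N \ (G.alt N e0).toks Z ⊆ P := by
  have hs' : s.tail = u2 := by rcases hs with rfl | rfl; exacts [F.tail_σ, F.tail_σ']
  have ht' : t.head = u1 := by rcases ht with rfl | rfl; exacts [F.head_τ, F.head_τ']
  obtain ⟨T, hT, hTv, hTu⟩ := F.exists_matching hZ (.inr hs') (.inl ht')
  refine ⟨N \ (G.alt N e0).toks Z ∪ T, ⟨by simp, by simp, fun v _ => ?_⟩, Set.subset_union_left⟩
  by_cases h1 : v = u1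
  · obtain ⟨f, hf, hft, hff⟩ : ∃ f ∈ N, f ≠ t.edge ∧ v ∈ G.inc f := by
      rcases ht with rfl | rfl
      · exact ⟨τ'.edge, τ'.edge_mem, F.τ_ne.symm, by rw [τ'.mem_inc, F.head_τ']; exact .inr h1⟩
      · exact ⟨τ.edge, τ.edge_mem, F.τ_ne, by rw [τ.mem_inc, F.head_τ]; exact .inr h1⟩
    refine ⟨f, ⟨.inl ⟨hf, fun h => ?_⟩, hff⟩, ?_⟩
    · rcases F.edge_of_root hZ h hff (.inl h1) with h | h
      · exact F.ne (h1 ▸ hs' ▸ h.2)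
      · exact hft h.1
    · rintro g ⟨hg | hg, hv⟩
      · have h3 := F.eq_τ g hg.1 (h1 ▸ hv)
        have h4 := F.eq_τ f hf (h1 ▸ hff)
        have h5 := F.eq_τ t.edge t.edge_mem (by simp [t.mem_inc, ht'])
        have h6 : g ≠ t.edge := fun h => hg.2 (h ▸ end_mem hZ)
        grind
      · exact absurd h1 (F.ne_of_step (hT g hg) hv).1
  by_cases h2 : v = u2
  · obtain ⟨f, hf, hft, hff⟩ : ∃ f ∈ N, f ≠ s.edge ∧ v ∈ G.inc f := by
      rcases hs with rfl | rfl
      · exact ⟨σ'.edge, σ'.edge_mem, F.σ_ne.symm, by rw [σ'.mem_inc, F.tail_σ']; exact .inl h2⟩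
      · exact ⟨σ.edge, σ.edge_mem, F.σ_ne, by rw [σ.mem_inc, F.tail_σ]; exact .inl h2⟩
    refine ⟨f, ⟨.inl ⟨hf, fun h => ?_⟩, hff⟩, ?_⟩
    · rcases F.edge_of_root hZ h hff (.inr h2) with h | h
      · exact hft h.1
      · exact h1 (ht' ▸ h.2)
    · rintro g ⟨hg | hg, hv⟩
      · have h3 := F.eq_σ g hg.1 (h2 ▸ hv)
        have h4 := F.eq_σ f hf (h2 ▸ hff)
        have h5 := F.eq_σ s.edge s.edge_mem (by simp [s.mem_inc, hs'])
        have h6 : g ≠ s.edge := fun h => hg.2 (h ▸ start_mem hZ)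
        grind
      · exact absurd h2 (F.ne_of_step (hT g hg) hv).2
  obtain ⟨e, ⟨he, hve⟩, hu⟩ := F.unique v h1 h2
  by_cases heZ : e ∈ (G.alt N e0).toks Z
  · obtain ⟨g, ⟨hg, hvg⟩, hgu⟩ := hTu e heZ v hve h1 h2
    refine ⟨g, ⟨.inr hg, hvg⟩, ?_⟩
    rintro g' ⟨hg' | hg', hv⟩
    · exact absurd heZ (hu g' ⟨hg'.1, hv⟩ ▸ hg'.2)
    · exact hgu _ ⟨hg', hv⟩
  · refine ⟨e, ⟨.inl ⟨he, heZ⟩, hve⟩, ?_⟩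
    rintro g' ⟨hg' | hg', hv⟩
    · exact hu g' ⟨hg'.1, hv⟩
    · obtain ⟨e', he', hve'⟩ := hTv g' hg' v hv
      exact absurd he' (hu e' ⟨toks_subset _ he', hve'⟩ ▸ heZ)

/-- Exchanging along disjoint alternating closed paths at `u2` and at `u1` yields a perfect
matching through `e0`. -/
lemma exists_isPM_of_closed (F : Frame e0 u1 u2 σ σ' τ τ')
    (hD : (G.alt N e0).IsPath σ σ'.rev D) (hL : (G.alt N e0).IsPath τ.rev τ' L)
    (hDL : ∀ e ∈ (G.alt N e0).toks D, e ∉ (G.alt N e0).toks L) :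
    ∃ P, G.IsPM P ∧ N \ ((G.alt N e0).toks D ∪ (G.alt N e0).toks L) ⊆ P := by
  obtain ⟨T, hT, hTv, hTu⟩ := F.exists_matching hD (.inr F.tail_σ) (.inr F.tail_σ')
  obtain ⟨T', hT', hTv', hTu'⟩ := F.exists_matching hL (.inl F.head_τ) (.inl F.head_τ')
  refine ⟨N \ ((G.alt N e0).toks D ∪ (G.alt N e0).toks L) ∪ (insert e0 (T ∪ T')),
    ⟨by simp, by simp, fun v _ => ?_⟩, Set.subset_union_left⟩
  have he0 : v ∈ G.inc e0 ↔ v = u1 ∨ v = u2 := by simp [F.inc_e0]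
  by_cases hr : v = u1 ∨ v = u2
  · refine ⟨e0, ⟨by simp, he0.2 hr⟩, ?_⟩
    rintro g ⟨⟨hg, hg'⟩ | rfl | hg | hg, hv⟩
    · refine absurd ?_ hg'
      rcases hr with rfl | rfl
      · rcases F.eq_τ g hg hv with rfl | rfl
        · exact .inr (show τ.rev.edge ∈ _ from start_mem hL)
        · exact .inr (end_mem hL)
      · rcases F.eq_σ g hg hv with rfl | rfl
        · exact .inl (start_mem hD)
        · exact .inl (show σ'.rev.edge ∈ _ from end_mem hD)
    · rfl
    · have := F.ne_of_step (hT g hg) hv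
      tauto
    · have := F.ne_of_step (hT' g hg) hv
      tauto
  obtain ⟨h1, h2⟩ := not_or.1 hr
  obtain ⟨e, ⟨he, hve⟩, hu⟩ := F.unique v h1 h2
  have hu' : ∀ l, (∃ f ∈ (G.alt N e0).toks l, v ∈ G.inc f) → e ∈ (G.alt N e0).toks l := by
    rintro l ⟨f, hf, hv⟩
    exact hu f ⟨toks_subset _ hf, hv⟩ ▸ hf
  by_cases heD : e ∈ (G.alt N e0).toks D
  · obtain ⟨g, ⟨hg, hvg⟩, hgu⟩ := hTu e heD v hve h1 h2
    refine ⟨g, ⟨.inr (.inr (.inl hg)), hvg⟩, ?_⟩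
    rintro g' ⟨hg' | rfl | hg' | hg', hv⟩
    · exact absurd (.inl heD) (hu g' ⟨hg'.1, hv⟩ ▸ hg'.2)
    · exact absurd (he0.1 hv) hr
    · exact hgu _ ⟨hg', hv⟩
    · exact absurd (hu' _ (hTv' g' hg' v hv)) (hDL _ heD)
  by_cases heL : e ∈ (G.alt N e0).toks L
  · obtain ⟨g, ⟨hg, hvg⟩, hgu⟩ := hTu' e heL v hve h1 h2
    refine ⟨g, ⟨.inr (.inr (.inr hg)), hvg⟩, ?_⟩
    rintro g' ⟨hg' | rfl | hg' | hg', hv⟩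
    · exact absurd (.inr heL) (hu g' ⟨hg'.1, hv⟩ ▸ hg'.2)
    · exact absurd (he0.1 hv) hr
    · exact absurd (hu' _ (hTv g' hg' v hv)) heD
    · exact hgu _ ⟨hg', hv⟩
  refine ⟨e, ⟨.inl ⟨he, not_or.2 ⟨heD, heL⟩⟩, hve⟩, ?_⟩
  rintro g' ⟨hg' | rfl | hg' | hg', hv⟩
  · exact hu g' ⟨hg'.1, hv⟩
  · exact absurd (he0.1 hv) hr
  · exact absurd (hu' _ (hTv g' hg' v hv)) heD
  · exact absurd (hu' _ (hTv' g' hg' v hv)) heL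

end Frame

end Multigraph

namespace Multigraph

variable {V E : Type*} {G : Multigraph V E} {N X : Set E} {e0 : E} {u1 u2 : V}

namespace Frame

variable {σ σ' τ τ' s t w d d' : G.Dart N} {P L Z Z' LC L4 a b : List (G.Dart N)}

/-- A path from `u2` that leaves for the closed path `L` at `u1` can be continued to `u1`. -/
lemma exists_isPM_of_crossing (F : Frame e0 u1 u2 σ σ' τ τ')
    (hab : (G.alt N e0).IsPath s w (a ++ d :: b)) (hs : s = σ ∨ s = σ')
    (hL : (G.alt N e0).IsPath τ.rev τ' L) (hsL : s.edge ∉ (G.alt N e0).toks L)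
    (hd : d.edge ∈ (G.alt N e0).toks L) (ha : ∀ e ∈ (G.alt N e0).toks a, e ∉ (G.alt N e0).toks L) :
    (∃ t, (G.alt N e0).IsPath s t a) ∧
      ∃ P, G.IsPM P ∧ N \ ((G.alt N e0).toks a ∪ (G.alt N e0).toks L) ⊆ P := by
  obtain ⟨t, ht, l, hl, hlL⟩ : ∃ t, (t = τ ∨ t = τ') ∧ ∃ l, (G.alt N e0).IsPath d t (d :: l) ∧
      ∀ e ∈ (G.alt N e0).toks (d :: l), e ∈ (G.alt N e0).toks L := by
    obtain ⟨x, hx, hxd⟩ := hd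
    have key : ∀ L' u t', (G.alt N e0).IsPath u t' L' → d ∈ L' → ∃ l,
        (G.alt N e0).IsPath d t' (d :: l) ∧
          ∀ e ∈ (G.alt N e0).toks (d :: l), e ∈ (G.alt N e0).toks L' := by
      intro L' u t' h h'
      obtain ⟨p, q, rfl⟩ := List.append_of_mem h'
      refine ⟨q, ⟨(List.isChain_append.1 h.chain).2.1, ?_, rfl, ?_⟩, ?_⟩
      · exact ((SkewGraph.distinct_append _ _ _).1 h.distinct).2.1
      · simpa using h.last
      · intro e he
        rw [SkewGraph.mem_toks_append]
        exact .inr he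
    rcases (G.alt N e0).eq_or_eq_ν x d hxd with rfl | rfl
    · exact ⟨τ', .inr rfl, key L _ _ hL hx⟩
    · obtain ⟨l, h, h'⟩ := key _ _ _ hL.mirror (by simpa [SkewGraph.ν_ν] using hx)
      exact ⟨τ, .inl rfl, l, h, by simpa only [SkewGraph.mem_toks_mirror] using h'⟩
  have hc := List.isChain_append.1 hab.chain
  have hdis := (SkewGraph.distinct_append _ _ _).1 hab.distinct
  rcases a.eq_nil_or_concat with rfl | ⟨a', x, hax⟩
  · have := hab.head
    simp only [List.nil_append, List.head?_cons, Option.some_inj] at this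
    exact absurd hd (this ▸ hsL)
  have hhead : a.head? = some s := by
    have := hab.head
    rwa [List.head?_append_of_ne_nil _ (by simp [hax])] at this
  refine ⟨⟨x, hc.1, hdis.1, hhead, by simp [hax]⟩, ?_⟩
  have hZ : (G.alt N e0).IsPath s t (a ++ d :: l) := by
    refine ⟨List.isChain_append.2 ⟨hc.1, hl.chain, ?_⟩, ?_, ?_, ?_⟩
    · simpa using hc.2.2
    · exact (SkewGraph.distinct_append _ _ _).2 ⟨hdis.1, hl.distinct, fun e h h' =>
        ha e h (hlL e h')⟩
    · rw [List.head?_append, hhead]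
      rfl
    · simpa using hl.last
  obtain ⟨P, hP, hNP⟩ := F.exists_isPM_of_path hZ hs ht
  refine ⟨P, hP, fun e he => hNP ⟨he.1, fun h => he.2 ?_⟩⟩
  exact ((SkewGraph.mem_toks_append _ _ _ _).1 h).imp_right (hlL e)

lemma exists_cover_of_pair (F : Frame e0 u1 u2 σ σ' τ τ') {A B : Set E}
    (h : (G.alt N e0).Pair σ σ' τ τ' {e | e ∈ X ∧ e ∉ A}) (hXB : ∀ e ∈ X, e ∉ B)
    (hB : ∃ P, G.IsPM P ∧ N \ (A ∪ B) ⊆ P) :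
    ∃ Ma Mb Mc, G.IsPM Ma ∧ G.IsPM Mb ∧ G.IsPM Mc ∧ N ⊆ Ma ∪ Mb ∪ Mc := by
  obtain ⟨s, s', t, t', Z, Z', hs, hs', ht, ht', hZ, hZ', hO⟩ := h
  obtain ⟨P, hP, hNP⟩ := F.exists_isPM_of_path hZ hs ht
  obtain ⟨P', hP', hNP'⟩ := F.exists_isPM_of_path hZ' hs' ht'
  obtain ⟨Q, hQ, hNQ⟩ := hB
  refine ⟨P, P', Q, hP, hP', hQ, fun e he => ?_⟩
  by_cases h1 : e ∈ (G.alt N e0).toks Z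
  · by_cases h2 : e ∈ (G.alt N e0).toks Z'
    · obtain ⟨hX, hA⟩ := hO e h1 h2
      exact .inr (hNQ ⟨he, not_or.2 ⟨hA, hXB e hX⟩⟩)
    · exact .inl (.inr (hNP' ⟨he, h2⟩))
  · exact .inl (.inl (hNP ⟨he, h1⟩))

/-- Three perfect matchings cover `N`, provided that `N` is the union of two alternating closed
paths `P` at `u2` and `L` at `u1`, and that there are alternating closed paths `LC` at `u1`
meeting `P`, and `L4` at `u2` meeting `LC` nowhere in `P`. -/
theorem exists_cover (F : Frame e0 u1 u2 σ σ' τ τ')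
    (hP : (G.alt N e0).IsPath σ σ'.rev P) (hL : (G.alt N e0).IsPath τ.rev τ' L)
    (hLC : (G.alt N e0).IsPath τ.rev τ' LC) (hL4 : (G.alt N e0).IsPath σ σ'.rev L4)
    (hPL : ∀ e ∈ (G.alt N e0).toks P, e ∉ (G.alt N e0).toks L)
    (hN : N ⊆ (G.alt N e0).toks P ∪ (G.alt N e0).toks L)
    (hmeet : ∃ e ∈ (G.alt N e0).toks P, e ∈ (G.alt N e0).toks LC)
    (hdisj : ∀ e ∈ (G.alt N e0).toks L4, e ∈ (G.alt N e0).toks P → e ∉ (G.alt N e0).toks LC) :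
    ∃ Ma Mb Mc, G.IsPM Ma ∧ G.IsPM Mb ∧ G.IsPM Mc ∧ N ⊆ Ma ∪ Mb ∪ Mc := by
  have H : (G.alt N e0).Hub ((G.alt N e0).toks P) σ σ' τ τ' [] P [] LC :=
    ⟨by rw [List.nil_append, List.append_nil]; exact hP, hLC, fun _ h => h, by simp, by simp, hmeet⟩
  have hnL : ∀ e ∈ N, e ∉ (G.alt N e0).toks L → e ∈ (G.alt N e0).toks P := fun e he h =>
    (hN he).resolve_right h
  by_cases hX : ∃ e ∈ (G.alt N e0).toks L4, e ∈ (G.alt N e0).toks L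
  · obtain ⟨a, d, b, hab, hd, ha⟩ := SkewGraph.exists_first _ hX
    obtain ⟨a', d', b', hab', hd', hb'⟩ := SkewGraph.exists_last _ hX
    have h1 := hL4
    rw [hab] at h1
    have h2 := hL4.mirror
    rw [hab'] at h2
    simp only [SkewGraph.mirror_append, SkewGraph.mirror_cons, List.append_assoc,
      List.singleton_append] at h2
    obtain ⟨⟨t, hα⟩, hα'⟩ := F.exists_isPM_of_crossing h1 (.inl rfl) hL
      (hPL _ (start_mem hP)) hd ha
    obtain ⟨⟨t', hβ⟩, hβ'⟩ := F.exists_isPM_of_crossing h2 (.inr rfl) hL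
      (hPL _ (show σ'.rev.edge ∈ _ from end_mem hP)) hd'
      (by simpa only [SkewGraph.mem_toks_mirror] using hb')
    have hαP : ∀ e ∈ (G.alt N e0).toks a, e ∈ (G.alt N e0).toks P := fun e h =>
      hnL e (toks_subset _ h) (ha e h)
    have hβP : ∀ e ∈ (G.alt N e0).toks ((G.alt N e0).mirror b'), e ∈ (G.alt N e0).toks P :=
      fun e h => hnL e (toks_subset _ h) (hb' e (by simpa only [SkewGraph.mem_toks_mirror] using h))
    have hαβ : ∀ e ∈ (G.alt N e0).toks a, e ∉ (G.alt N e0).toks ((G.alt N e0).mirror b') := by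
      have hdis := hL4.distinct
      obtain ⟨r, rfl⟩ : ∃ r, a' = a ++ r := by
        rcases SkewGraph.split_cases (hab.symm.trans hab') with ⟨r, rfl, -⟩ | ⟨rfl, -, -⟩ |
          ⟨r, rfl, -⟩
        · exact ⟨_, rfl⟩
        · exact ⟨[], by simp⟩
        · exact absurd hd' (ha _ (by simp))
      rw [hab'] at hdis
      simp only [SkewGraph.distinct_append, SkewGraph.distinct_cons, SkewGraph.mem_toks_append,
        SkewGraph.mem_toks_cons, SkewGraph.mem_toks_mirror] at hdis ⊢
      intro e he hb
      exact hdis.2.2 e (.inl he) (.inr hb)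
    have hαC : ∀ e ∈ (G.alt N e0).toks a, e ∉ (G.alt N e0).toks LC := fun e h =>
      hdisj e (by rw [hab, SkewGraph.mem_toks_append]; exact .inl h) (hαP e h)
    have hβC : ∀ e ∈ (G.alt N e0).toks ((G.alt N e0).mirror b'), e ∉ (G.alt N e0).toks LC := by
      intro e h
      refine hdisj e ?_ (hβP e h)
      rw [SkewGraph.mem_toks_mirror] at h
      rw [hab', SkewGraph.mem_toks_append, SkewGraph.mem_toks_cons]
      exact .inr (.inr h)
    rcases H.pair_crossing hα hβ hαP hβP hαC hβC hαβ with h | h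
    · exact F.exists_cover_of_pair h hPL hα'
    · exact F.exists_cover_of_pair h hPL hβ'
  · have h4 : ∀ e ∈ (G.alt N e0).toks L4, e ∈ (G.alt N e0).toks P := fun e h =>
      hnL e (toks_subset _ h) fun h' => hX ⟨e, h, h'⟩
    obtain ⟨Q, hQ, hQP, h⟩ := H.goal (M := L4) (by rw [List.nil_append, List.append_nil]; exact hL4)
      (by simpa using h4)
      (by simpa using fun e h => hdisj e h (h4 e h))
    exact F.exists_cover_of_pair h hPL
      (F.exists_isPM_of_closed hQ hL fun e he => hPL e (hQP e he))

end Frame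

end Multigraph

namespace Multigraph

variable {V E : Type*} {G : Multigraph V E} {N X : Set E} {e0 : E} {u1 u2 : V}

lemma exists_dart {v : V} {e : E} (he : e ∈ N) (hv : v ∈ G.inc e) :
    ∃ d : G.Dart N, d.edge = e ∧ d.tail = v := by
  obtain ⟨w, hw⟩ := Sym2.mem_iff_exists.1 hv
  exact ⟨⟨v, w, e, he, hw⟩, rfl, rfl⟩

namespace Frame

variable {σ σ' τ τ' d : G.Dart N} {L : List (G.Dart N)} {v : V} {e : E}

lemma exists_step_edge (F : Frame e0 u1 u2 σ σ' τ τ') (hX : G.IsCircuit X) (hu1 : u1 ∉ G.supp X)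
    (hN : ∀ v ∈ G.supp X, v ≠ u2 → ∃ e ∈ X, e ∈ N ∧ v ∈ G.inc e) (hv : v ∈ G.supp X)
    (hv2 : v ≠ u2) : ∃ g ∈ X, g ∉ N ∧ v ∈ G.inc g ∧ ∀ e ∈ X, v ∈ G.inc e → e ∉ N → e = g := by
  have hv1 : v ≠ u1 := fun h => hu1 (h ▸ hv)
  obtain ⟨x, y, hxy, h⟩ := Set.ncard_eq_two.1 (hX.2.1 v hv)
  have h : ∀ e, e ∈ X ∧ v ∈ G.inc e ↔ e = x ∨ e = y := fun e => by
    simpa using Set.ext_iff.1 h e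
  obtain ⟨e, heX, heN, hve⟩ := hN v hv hv2
  have hu : ∀ f, f ∈ N → v ∈ G.inc f → f = e := fun f hf hvf => F.edge_eq hv1 hv2 hf heN hvf hve
  have hx := (h x).2 (.inl rfl)
  have hy := (h y).2 (.inr rfl)
  have he := (h e).1 ⟨heX, hve⟩
  by_cases hxN : x ∈ N
  · refine ⟨y, hy.1, fun hyN => hxy ?_, hy.2, fun f hf hvf hfN => ?_⟩
    · rw [hu x hxN hx.2, hu y hyN hy.2]
    · rcases (h f).1 ⟨hf, hvf⟩ with rfl | rfl
      exacts [absurd hxN hfN, rfl]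
  · refine ⟨x, hx.1, hxN, hx.2, fun f hf hvf hfN => ?_⟩
    rcases (h f).1 ⟨hf, hvf⟩ with rfl | rfl
    · rfl
    · rcases he with rfl | rfl
      exacts [absurd heN hxN, absurd heN hfN]

/-- An alternating trail in a circuit through `u2` can be extended until it returns to `u2`. -/
lemma exists_path_of_isCircuit [Finite E] (F : Frame e0 u1 u2 σ σ' τ τ') (hX : G.IsCircuit X)
    (he0 : e0 ∉ X) (hu1 : u1 ∉ G.supp X)
    (hN : ∀ v ∈ G.supp X, v ≠ u2 → ∃ e ∈ X, e ∈ N ∧ v ∈ G.inc e)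
    (hc : L.IsChain (G.darts N (X \ N)).R) (hd : (G.alt N e0).Distinct L)
    (hs : L.head? = some σ) (hLX : (G.alt N e0).toks L ⊆ X) :
    ∃ L, L.IsChain (G.darts N (X \ N)).R ∧ (G.alt N e0).IsPath σ σ'.rev L ∧
      (G.alt N e0).toks L ⊆ X := by
  have hR : ∀ l : List (G.Dart N), l.IsChain (G.darts N (X \ N)).R → l.IsChain (G.alt N e0).R :=
    fun l => List.IsChain.imp fun a b ⟨g, hg, h⟩ => ⟨g, ⟨hg.2, fun h => he0 (h ▸ hg.1)⟩, h⟩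
  have := Fintype.ofFinite E
  have hlen : ∀ l : List (G.Dart N), (G.alt N e0).Distinct l → l.length ≤ Fintype.card E := by
    intro l hl
    rw [← List.length_map Dart.edge]
    exact List.Nodup.length_le_card (List.pairwise_map.2 hl)
  induction hn : Fintype.card E - L.length using Nat.strong_induction_on generalizing L with
  | _ n ih =>
    subst hn
    rcases L.eq_nil_or_concat with rfl | ⟨L, d, rfl⟩
    · simp at hs
    rw [List.concat_eq_append] at hc hd hs hLX ih
    have hdX : d.edge ∈ X := hLX (SkewGraph.tok_mem_toks (S := G.alt N e0) (by simp))
    have hmem : ∀ e, e ∈ (G.alt N e0).toks (L ++ [d]) ↔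
        e ∈ (G.alt N e0).toks L ∨ e = d.edge := fun e => by
      simp [alt, darts]
    have hdL : d.edge ∉ (G.alt N e0).toks L := by
      have := ((SkewGraph.distinct_append _ _ _).1 hd).2.2
      intro h
      exact this _ h (by simp [alt, darts])
    by_cases h2 : d.head = u2
    · refine ⟨L ++ [d], hc, ⟨hR _ hc, hd, hs, ?_⟩, hLX⟩
      suffices d = σ'.rev by simp [this]
      rcases F.eq_σ d.edge d.edge_mem (by simp [d.mem_inc, h2]) with h | h
      · cases L with
        | nil =>
          obtain rfl : d = σ := by simpa using hs
          exact absurd (F.tail_σ.trans h2.symm) d.tail_ne_head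
        | cons x L =>
          obtain rfl : x = σ := by simpa using hs
          refine absurd ?_ hdL
          simp [h, darts]
      · rcases (G.alt N e0).eq_or_eq_ν σ' d h.symm with rfl | h
        · exact absurd (F.tail_σ'.trans h2.symm) σ'.tail_ne_head
        · exact h.symm
    have hdv : d.head ∈ G.supp X := ⟨_, hdX, by simp [d.mem_inc]⟩
    obtain ⟨g, hgX, hgN, hdg, hgu⟩ := F.exists_step_edge hX hu1 hN hdv h2
    obtain ⟨w, hw⟩ := Sym2.mem_iff_exists.1 hdg
    have hge : g ≠ e0 := fun h => he0 (h ▸ hgX)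
    have hwX : w ∈ G.supp X := ⟨g, hgX, by simp [hw]⟩
    have hdw := F.ne_of_step ⟨hgN, hge⟩ hdg
    obtain ⟨hw1, hw2⟩ := F.ne_of_step (v := w) ⟨hgN, hge⟩ (by simp [hw])
    have hvw : d.head ≠ w := by
      intro h
      have := G.no_loops g
      rw [hw, h] at this
      simp at this
    obtain ⟨e, heX, heN, hwe⟩ := hN w hwX hw2
    obtain ⟨d', rfl, rfl⟩ := exists_dart heN hwe
    have back : ∀ g' ∈ X \ N, ∀ z, G.inc g' = s(z, d'.tail) → z = d.head := by
      intro g' hg' z hz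
      obtain ⟨g₁, -, -, -, hu⟩ := F.exists_step_edge hX hu1 hN hwX hw2
      obtain rfl : g' = g := by
        rw [hu g' hg'.1 (by simp [hz]) hg'.2, hu g hgX (by simp [hw]) hgN]
      rw [hw, Sym2.eq_iff] at hz
      grind
    have hnew : d'.edge ∉ (G.alt N e0).toks (L ++ [d]) := by
      have same : ∀ z : G.Dart N, d.head ∈ G.inc z.edge → z.edge = d.edge := fun z hz =>
        F.edge_eq hdw.1 hdw.2 z.edge_mem d.edge_mem hz (by simp [d.mem_inc])
      rintro ⟨x, hx, hxd⟩
      obtain ⟨a, b, hab⟩ := List.append_of_mem hx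
      have hlast : (a ++ x :: b).getLast? = some d := by simp [← hab]
      rw [hab] at hc hd hs
      rw [SkewGraph.distinct_append, SkewGraph.distinct_cons] at hd
      rcases (G.alt N e0).eq_or_eq_ν x d' hxd with rfl | rfl
      · rcases a.eq_nil_or_concat with rfl | ⟨a, y, rfl⟩
        · obtain rfl : x = σ := by simpa using hs
          exact hw2 F.tail_σ
        · rw [List.concat_eq_append, List.append_assoc] at hc
          obtain ⟨g', hg', hgi⟩ := (List.isChain_cons_cons.1 (List.isChain_append.1 hc).2.1).1
          have hy := same y (by simp [y.mem_inc, ← back g' hg' _ hgi])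
          refine hd.2.2 d.edge ⟨y, by simp, hy⟩ ⟨d, ?_, rfl⟩
          exact List.mem_of_mem_getLast? (by simpa using hlast)
      · cases b with
        | nil =>
          obtain rfl : x = d := by simpa using hlast
          exact hvw rfl
        | cons z b =>
          obtain ⟨g', hg', hgi⟩ := (List.isChain_cons_cons.1 (List.isChain_append.1 hc).2.1).1
          have hzd := back g' hg' z.tail (by rw [hgi, Sym2.eq_swap]; rfl)
          have hz := same z (by simp [z.mem_inc, hzd])
          cases b with
          | nil =>
            obtain rfl : z = d := by simpa using hlast
            exact z.tail_ne_head hzd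
          | cons z' b =>
            rw [SkewGraph.distinct_cons] at hd
            refine hd.2.1.2.1 ⟨d, ?_, hz.symm⟩
            exact List.mem_of_mem_getLast? (by simpa using hlast)
    have hd' : (G.alt N e0).Distinct (L ++ [d] ++ [d']) := by
      rw [SkewGraph.distinct_append]
      refine ⟨hd, by simp [SkewGraph.Distinct], fun e he he' => hnew ?_⟩
      obtain rfl : e = d'.edge := by simpa [darts] using he'
      exact he
    refine ih _ ?_ ?_ hd' ?_ ?_ rfl
    · have := hlen _ hd'
      simp at this ⊢
      omega
    · refine List.isChain_append.2 ⟨hc, by simp, ?_⟩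
      simpa using ⟨g, ⟨hgX, hgN⟩, hw⟩
    · rw [List.head?_append, hs]
      rfl
    · intro e he
      rw [SkewGraph.mem_toks_append] at he
      rcases he with he | he
      · exact hLX he
      · obtain rfl : e = d'.edge := by simpa [darts] using he
        exact heX

end Frame

end Multigraph

namespace Multigraph

variable {V E : Type*} {G : Multigraph V E} {N X : Set E} {e0 : E} {u1 u2 : V}

namespace Frame

variable {σ σ' τ τ' d : G.Dart N} {L : List (G.Dart N)} {v : V} {e : E}

/-- An alternating circuit through `u2` is traversed by a closed path at `u2`. -/
theorem exists_closed_path [Finite E] (F : Frame e0 u1 u2 σ σ' τ τ') (hX : G.IsCircuit X)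
    (he0 : e0 ∉ X) (hu1 : u1 ∉ G.supp X) (hσ : σ.edge ∈ X)
    (hN : ∀ v ∈ G.supp X, v ≠ u2 → ∃ e ∈ X, e ∈ N ∧ v ∈ G.inc e) :
    ∃ L, (G.alt N e0).IsPath σ σ'.rev L ∧ (G.alt N e0).toks L = X ∩ N := by
  obtain ⟨L, hc, hL, hLX⟩ := F.exists_path_of_isCircuit (L := [σ]) hX he0 hu1 hN (by simp)
    (by simp [SkewGraph.Distinct]) rfl (by rintro e ⟨x, hx, rfl⟩; simp_all [darts])
  refine ⟨L, hL, (Set.subset_inter hLX (toks_subset L)).antisymm ?_⟩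
  have root : ∀ e ∈ N, u2 ∈ G.inc e → e ∈ (G.alt N e0).toks L := by
    intro e he h
    rcases F.eq_σ e he h with rfl | rfl
    exacts [start_mem hL, show σ'.rev.edge ∈ _ from end_mem hL]
  have unroot : ∀ v, v ≠ u2 → (∃ f ∈ (G.alt N e0).toks L, v ∈ G.inc f) →
      ∀ e ∈ N, v ∈ G.inc e → e ∈ (G.alt N e0).toks L := by
    rintro v hv2 ⟨f, hf, hvf⟩ e he hve
    have hv1 : v ≠ u1 := fun h => hu1 (h ▸ ⟨f, hLX hf, hvf⟩)
    exact F.edge_eq hv1 hv2 he (toks_subset _ hf) hve hvf ▸ hf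
  have closed : ∀ v w, (∃ f ∈ (G.alt N e0).toks L, v ∈ G.inc f) → G.Adj X v w →
      ∃ f ∈ (G.alt N e0).toks L, w ∈ G.inc f := by
    rintro v w hv ⟨e, heX, hi⟩
    by_cases heN : e ∈ N
    · refine ⟨e, ?_, by simp [hi]⟩
      by_cases hv2 : v = u2
      · exact root e heN (by simp [hi, hv2])
      · exact unroot v hv2 hv e heN (by simp [hi])
    have hv2 : v ≠ u2 := (F.ne_of_step ⟨heN, fun h => he0 (h ▸ heX)⟩ (by simp [hi])).2
    obtain ⟨f, ⟨x, hx, rfl⟩, hvf⟩ := hv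
    have hvX : v ∈ G.supp X := ⟨_, hLX ⟨x, hx, rfl⟩, hvf⟩
    obtain ⟨g, hgX, hgN, hvg, hu⟩ := F.exists_step_edge hX hu1 hN hvX hv2
    rcases x.mem_inc.1 hvf with rfl | rfl
    · rcases SkewGraph.eq_head_or_exists hc hx with h | ⟨y, hy, g', hg', hgi⟩
      · rw [hL.head, Option.some_inj] at h
        exact absurd (h ▸ F.tail_σ) hv2
      · refine ⟨y.edge, ⟨y, hy, rfl⟩, ?_⟩
        rw [hu g' hg'.1 (by simp [hgi]) hg'.2, ← hu e heX (by simp [hi]) heN, hi,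
          Sym2.eq_iff] at hgi
        rw [y.mem_inc]
        grind
    · rcases SkewGraph.eq_last_or_exists hc hx with h | ⟨y, hy, g', hg', hgi⟩
      · rw [hL.last, Option.some_inj] at h
        exact absurd (h ▸ F.tail_σ') hv2
      · refine ⟨y.edge, ⟨y, hy, rfl⟩, ?_⟩
        rw [hu g' hg'.1 (by simp [hgi]) hg'.2, ← hu e heX (by simp [hi]) heN, hi,
          Sym2.eq_iff] at hgi
        rw [y.mem_inc]
        grind
  have reach : ∀ v, G.Reach X u2 v → ∃ f ∈ (G.alt N e0).toks L, v ∈ G.inc f := by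
    intro v h
    induction h with
    | refl => exact ⟨_, start_mem hL, by simp [σ.mem_inc, F.tail_σ]⟩
    | tail _ h ih => exact closed _ _ ih h
  rintro e ⟨heX, heN⟩
  induction hi : G.inc e with
  | _ v w =>
    have hve : v ∈ G.inc e := by simp [hi]
    by_cases hv2 : v = u2
    · exact root e heN (hv2 ▸ hve)
    · have hσX : u2 ∈ G.supp X := ⟨_, hσ, by simp [σ.mem_inc, F.tail_σ]⟩
      exact unroot v hv2 (reach v (hX.2.2 u2 hσX v ⟨e, heX, hve⟩)) e heN hve

end Frame

end Multigraph

namespace Multigraph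

variable {V E : Type*} {G : Multigraph V E} {M X Y : Set E} {e0 : E} {u1 u2 : V}

lemma exists_two_edges {v : V} (h : G.deg X v = 2) :
    ∃ x y, x ≠ y ∧ ∀ e, e ∈ X ∧ v ∈ G.inc e ↔ e = x ∨ e = y := by
  obtain ⟨x, y, hxy, h⟩ := Set.ncard_eq_two.1 h
  exact ⟨x, y, hxy, fun e => by simpa using Set.ext_iff.1 h e⟩

/-- A subgraph of degree two in a cubic graph misses at most one edge at each of its vertices. -/
lemma IsCubic.mem_of_deg [Finite E] (hG : G.IsCubic) {v : V} (h : G.deg X v = 2) {e f : E}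
    (hf : f ∉ X) (hvf : v ∈ G.inc f) (hve : v ∈ G.inc e) (hef : e ≠ f) : e ∈ X := by
  have h3 : {e ∈ Set.univ | v ∈ G.inc e}.ncard = 3 := hG v
  have hsub : {e ∈ X | v ∈ G.inc e} ⊆ {e ∈ Set.univ | v ∈ G.inc e} \ {f} := fun e he =>
    ⟨⟨trivial, he.2⟩, fun h => hf (h ▸ he.1)⟩
  have hcard := Set.ncard_sdiff_singleton_of_mem (s := {e ∈ Set.univ | v ∈ G.inc e}) (a := f)
    ⟨trivial, hvf⟩
  have := Set.eq_of_subset_of_ncard_le hsub (by rw [hcard, h3]; exact h.ge)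
  exact (this.ge ⟨⟨trivial, hve⟩, hef⟩).1

/-- Outside a perfect matching consisting of `e0` and edges of the `2`-factor `X ∪ Y`, the circuit
`X` has exactly one edge at each vertex not on `e0`. -/
lemma IsCircuit.existsUnique_edge (hX : G.IsCircuit X)
    (hXY : ∀ v ∈ G.supp X, ∀ e ∈ Y, v ∉ G.inc e) (hM : G.IsPM M) (hMsub : M \ {e0} ⊆ X ∪ Y)
    {v : V} (hv : v ∈ G.supp X) (hve0 : v ∉ G.inc e0) :
    ∃! e, e ∈ (X ∪ Y) \ M ∧ v ∈ G.inc e := by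
  obtain ⟨f, ⟨hfM, hvf⟩, hu⟩ := hM.2.2 v trivial
  obtain ⟨x, y, hxy, h⟩ := exists_two_edges (hX.2.1 v hv)
  have hmem : ∀ e ∈ X ∪ Y, v ∈ G.inc e → e ∈ X := fun e he hve =>
    he.resolve_right fun h => hXY v hv e h hve
  have hfX : f ∈ X := hmem f (hMsub ⟨hfM, fun h => hve0 (h ▸ hvf)⟩) hvf
  have hx := (h x).2 (.inl rfl)
  have hy := (h y).2 (.inr rfl)
  rcases (h f).1 ⟨hfX, hvf⟩ with rfl | rfl
  · refine ⟨y, ⟨⟨.inl hy.1, fun h => hxy (hu y ⟨h, hy.2⟩).symm⟩, hy.2⟩, ?_⟩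
    rintro e ⟨⟨he, heM⟩, hve⟩
    rcases (h e).1 ⟨hmem e he hve, hve⟩ with rfl | rfl
    exacts [absurd hfM heM, rfl]
  · refine ⟨x, ⟨⟨.inl hx.1, fun h => hxy (hu x ⟨h, hx.2⟩)⟩, hx.2⟩, ?_⟩
    rintro e ⟨⟨he, heM⟩, hve⟩
    rcases (h e).1 ⟨hmem e he hve, hve⟩ with rfl | rfl
    exacts [rfl, absurd hfM heM]

/-- Two darts of `N` for the two edges of `X` at a vertex. -/
lemma exists_two_darts {N : Set E} {v : V} (h : G.deg X v = 2)
    (hN : ∀ e, v ∈ G.inc e → (e ∈ X ↔ e ∈ N)) :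
    ∃ d d' : G.Dart N, d.tail = v ∧ d'.tail = v ∧ d.edge ≠ d'.edge ∧
      ∀ e ∈ N, v ∈ G.inc e → e = d.edge ∨ e = d'.edge := by
  obtain ⟨x, y, hxy, h⟩ := exists_two_edges h
  have hx := (h x).2 (.inl rfl)
  have hy := (h y).2 (.inr rfl)
  obtain ⟨d, rfl, hd⟩ := exists_dart ((hN x hx.2).1 hx.1) hx.2
  obtain ⟨d', rfl, hd'⟩ := exists_dart ((hN y hy.2).1 hy.1) hy.2
  exact ⟨d, d', hd, hd', hxy, fun e he hv => (h e).1 ⟨(hN e hv).2 he, hv⟩⟩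

/-- Circuits in the complement of a perfect matching of a cubic graph are equal or disjoint. -/
lemma IsCircuit.subset_of_mem_supp [Finite E] (hG : G.IsCubic) (hM : G.IsPM M)
    (hX : G.IsCircuit X) (hY : G.IsCircuit Y) (hXM : X ⊆ Set.univ \ M) (hYM : Y ⊆ Set.univ \ M)
    {u : V} (huX : u ∈ G.supp X) (huY : u ∈ G.supp Y) : X ⊆ Y := by
  have key : ∀ v ∈ G.supp Y, ∀ e ∈ X, v ∈ G.inc e → e ∈ Y := by
    intro v hv e he hve
    obtain ⟨f, ⟨hfM, hvf⟩, -⟩ := hM.2.2 v trivial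
    exact hG.mem_of_deg (hY.2.1 v hv) (fun h => (hYM h).2 hfM) hvf hve
      fun h => (hXM he).2 (h ▸ hfM)
  have reach : ∀ v, G.Reach X u v → v ∈ G.supp Y := by
    intro v h
    induction h with
    | refl => exact huY
    | tail _ h ih =>
      obtain ⟨e, he, hi⟩ := h
      exact ⟨e, key _ ih e he (by simp [hi]), by simp [hi]⟩
  intro e he
  induction hi : G.inc e with
  | _ v w =>
    have hve : v ∈ G.inc e := by simp [hi]
    exact key v (reach v (hX.2.2 u huX v ⟨e, he, hve⟩)) e he hve

end Multigraph

open Multigraph in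
/-- Lemma 2 of the paper. -/
theorem statement_1 {V E : Type*} [Fintype V] [Fintype E] (G : Multigraph V E)
    (hcubic : G.IsCubic) (hbridgeless : G.Bridgeless)
    (C1 C2 : Set E) (hC1 : G.IsCircuit C1) (hC2 : G.IsCircuit C2)
    (hodd1 : Odd C1.ncard) (hodd2 : Odd C2.ncard)
    (hdisj : G.supp C1 ∩ G.supp C2 = ∅)
    (hspan : G.supp C1 ∪ G.supp C2 = Set.univ)
    (u1 u2 : V) (e12 : E) (hinc : G.inc e12 = s(u1, u2))
    (hu1 : u1 ∈ G.supp C1) (hu2 : u2 ∈ G.supp C2)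
    (M : Set E) (hM : G.IsPM M) (he12M : e12 ∈ M)
    (hMsub : M \ {e12} ⊆ C1 ∪ C2)
    (C3 C4 : Set E)
    (hC3 : G.IsCircuit C3) (hC3sub : C3 ⊆ Set.univ \ M) (hu1C3 : u1 ∈ G.supp C3)
    (hC4 : G.IsCircuit C4) (hC4sub : C4 ⊆ Set.univ \ M) (hu2C4 : u2 ∈ G.supp C4)
    (hne : C3 ≠ C4)
    (C : Set E) (hC : G.IsCircuit C) (hu1C : u1 ∈ G.supp C)
    -- (1) `(E(C1) \ M) \ E(C)` is a perfect matching of `C1 − (V(C) ∩ V(C1))`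
    (hcond1 : G.IsPMOn (G.supp C1 \ G.supp C) C1 ((C1 \ M) \ C))
    -- (2)
    (hcond2a : (C ∩ C2).Nonempty) (hcond2b : C ∩ C2 ⊆ C2 \ M)
    (hcond2c : C ∩ C2 ∩ C4 = ∅)
    -- (3) each component `Q` of `C` minus the edges of `E(C) ∩ E(C2)` which does
    -- not contain `u1` satisfies: `E(Q) ∩ (E(C1) \ M)` is a perfect matching of
    -- `Q − (V(Q) ∩ V(C2))`.
    (hcond3 : ∀ v ∈ G.supp C, ¬ G.Reach (C \ (C ∩ C2)) u1 v →
      G.IsPMOn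
        ({w | G.Reach (C \ (C ∩ C2)) v w} \ G.supp C2)
        {f ∈ C \ (C ∩ C2) | ∀ w ∈ G.inc f, G.Reach (C \ (C ∩ C2)) v w}
        ({f ∈ C \ (C ∩ C2) | ∀ w ∈ G.inc f, G.Reach (C \ (C ∩ C2)) v w} ∩ (C1 \ M))) :
    ∃ Ma Mb Mc : Set E, G.IsPM Ma ∧ G.IsPM Mb ∧ G.IsPM Mc ∧
      (C1 ∪ C2) \ M ⊆ Ma ∪ Mb ∪ Mc := by
  have hd12 : ∀ v ∈ G.supp C1, ∀ e ∈ C2, v ∉ G.inc e := fun v hv e he h =>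
    (hdisj.le ⟨hv, e, he, h⟩).elim
  have hd21 : ∀ v ∈ G.supp C2, ∀ e ∈ C1, v ∉ G.inc e := fun v hv e he h =>
    (hdisj.le ⟨⟨e, he, h⟩, hv⟩).elim
  have hcov : ∀ v, v ∈ G.supp C1 ∨ v ∈ G.supp C2 := fun v => hspan.ge trivial
  have he0 : ∀ v, v ∈ G.inc e12 ↔ v = u1 ∨ v = u2 := by simp [hinc]
  have he1 : u1 ∈ G.inc e12 := by simp [hinc]
  have he2 : u2 ∈ G.inc e12 := by simp [hinc]
  have he12C1 : e12 ∉ C1 := fun h => hd21 u2 hu2 e12 h he2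
  have he12C2 : e12 ∉ C2 := fun h => hd12 u1 hu1 e12 h he1
  have hMu : ∀ v, v ∈ G.inc e12 → ∀ f ∈ M, v ∈ G.inc f → f = e12 := fun v hv f hf hvf =>
    (hM.2.2 v trivial).unique ⟨hf, hvf⟩ ⟨he12M, hv⟩
  have hN1 : ∀ e, u1 ∈ G.inc e → (e ∈ C1 ↔ e ∈ (C1 ∪ C2) \ M) := by
    refine fun e hv => ⟨fun h => ⟨.inl h, fun h' => he12C1 (hMu u1 he1 e h' hv ▸ h)⟩, ?_⟩
    exact fun h => h.1.resolve_right fun h' => hd12 u1 hu1 e h' hv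
  have hN2 : ∀ e, u2 ∈ G.inc e → (e ∈ C2 ↔ e ∈ (C1 ∪ C2) \ M) := by
    refine fun e hv => ⟨fun h => ⟨.inr h, fun h' => he12C2 (hMu u2 he2 e h' hv ▸ h)⟩, ?_⟩
    exact fun h => h.1.resolve_left fun h' => hd21 u2 hu2 e h' hv
  obtain ⟨σ, σ', hσ, hσ', hσσ', hσu⟩ := exists_two_darts (hC2.2.1 u2 hu2) hN2
  obtain ⟨τ, τ', hτ, hτ', hττ', hτu⟩ := exists_two_darts (hC1.2.1 u1 hu1) hN1
  have F : Frame e12 u1 u2 σ σ' τ.rev τ'.rev := by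
    refine ⟨hinc, fun h => h.2 he12M, ?_, ?_, ?_, hσ, hσ', hτ, hτ', hσσ', hττ', hσu, hτu⟩
    · intro v h1 h2
      have hv : v ∉ G.inc e12 := fun h => ((he0 v).1 h).elim h1 h2
      rcases hcov v with h | h
      · exact hC1.existsUnique_edge hd12 hM hMsub h hv
      · rw [Set.union_comm] at hMsub ⊢
        exact hC2.existsUnique_edge hd21 hM hMsub h hv
    · exact fun g hg hg' hv =>
        hg ((hN1 g hv).1 (hcubic.mem_of_deg (hC1.2.1 u1 hu1) he12C1 he1 hv hg'))
    · exact fun g hg hg' hv =>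
        hg ((hN2 g hv).1 (hcubic.mem_of_deg (hC2.2.1 u2 hu2) he12C2 he2 hv hg'))
  have hσm : u2 ∈ G.inc σ.edge := by simp [σ.mem_inc, hσ]
  have hτm : u1 ∈ G.inc τ.edge := by simp [τ.mem_inc, hτ]
  have hex : ∀ v, ∃ e ∈ (C1 ∪ C2) \ M, v ∈ G.inc e := by
    intro v
    by_cases h1 : v = u1
    · exact ⟨τ.edge, τ.edge_mem, h1 ▸ hτm⟩
    by_cases h2 : v = u2
    · exact ⟨σ.edge, σ.edge_mem, h2 ▸ hσm⟩
    · obtain ⟨e, he, -⟩ := F.unique v h1 h2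
      exact ⟨e, he⟩
  have exists_path₂ : ∀ X, G.IsCircuit X → e12 ∉ X → u1 ∉ G.supp X → u2 ∈ G.supp X →
      (∀ v ∈ G.supp X, ∀ e ∈ (C1 ∪ C2) \ M, v ∈ G.inc e → e ∈ X) →
      ∃ L, (G.alt ((C1 ∪ C2) \ M) e12).IsPath σ σ'.rev L ∧
        (G.alt ((C1 ∪ C2) \ M) e12).toks L = X ∩ ((C1 ∪ C2) \ M) := by
    intro X hX h0 h1 h2 h
    refine F.exists_closed_path hX h0 h1 (h u2 h2 _ σ.edge_mem hσm) fun v hv _ => ?_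
    obtain ⟨e, he, hve⟩ := hex v
    exact ⟨e, h v hv e he hve, he, hve⟩
  have exists_path₁ : ∀ X, G.IsCircuit X → e12 ∉ X → u2 ∉ G.supp X → u1 ∈ G.supp X →
      (∀ v ∈ G.supp X, ∀ e ∈ (C1 ∪ C2) \ M, v ∈ G.inc e → e ∈ X) →
      ∃ L, (G.alt ((C1 ∪ C2) \ M) e12).IsPath τ τ'.rev L ∧
        (G.alt ((C1 ∪ C2) \ M) e12).toks L = X ∩ ((C1 ∪ C2) \ M) := by
    intro X hX h0 h1 h2 h
    refine F.symm.exists_closed_path hX h0 h1 (h u1 h2 _ τ.edge_mem hτm) fun v hv _ => ?_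
    obtain ⟨e, he, hve⟩ := hex v
    exact ⟨e, h v hv e he hve, he, hve⟩
  have hC1N : ∀ v ∈ G.supp C1, ∀ e ∈ (C1 ∪ C2) \ M, v ∈ G.inc e → e ∈ C1 := fun v hv e he hve =>
    he.1.resolve_right fun h => hd12 v hv e h hve
  have hC2N : ∀ v ∈ G.supp C2, ∀ e ∈ (C1 ∪ C2) \ M, v ∈ G.inc e → e ∈ C2 := fun v hv e he hve =>
    he.1.resolve_left fun h => hd21 v hv e h hve
  have hC4N : ∀ v ∈ G.supp C4, ∀ e ∈ (C1 ∪ C2) \ M, v ∈ G.inc e → e ∈ C4 := by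
    intro v hv e he hve
    obtain ⟨f, ⟨hfM, hvf⟩, -⟩ := hM.2.2 v trivial
    exact hcubic.mem_of_deg (hC4.2.1 v hv) (fun h => (hC4sub h).2 hfM) hvf hve
      fun h => he.2 (h ▸ hfM)
  have hCN1 : ∀ v ∈ G.supp C, v ∈ G.supp C1 → ∀ e ∈ (C1 ∪ C2) \ M, v ∈ G.inc e → e ∈ C := by
    intro v hv hv1 e he hve
    by_contra h
    exact (hcond1.2.1 e ⟨⟨hC1N v hv1 e he hve, he.2⟩, h⟩ v hve).2 hv
  have he12C : e12 ∉ C := by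
    intro h
    obtain ⟨x, y, hxy, hC'⟩ := exists_two_edges (hC.2.1 u1 hu1C)
    have h1 := (hC' e12).1 ⟨h, he1⟩
    have h2 := (hC' _).1 ⟨hCN1 u1 hu1C hu1 _ τ.edge_mem hτm, hτm⟩
    have hτm' : u1 ∈ G.inc τ'.edge := by simp [τ'.mem_inc, hτ']
    have h3 := (hC' _).1 ⟨hCN1 u1 hu1C hu1 _ τ'.edge_mem hτm', hτm'⟩
    have h4 : τ.edge ≠ e12 := fun h => τ.edge_mem.2 (h ▸ he12M)
    have h5 : τ'.edge ≠ e12 := fun h => τ'.edge_mem.2 (h ▸ he12M)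
    grind
  have hCN2 : ∀ v ∈ G.supp C, v ∈ G.supp C2 → ∀ e ∈ (C1 ∪ C2) \ M, v ∈ G.inc e → e ∈ C := by
    intro v hv hv2 e he hve
    obtain ⟨f, ⟨hfM, hvf⟩, -⟩ := hM.2.2 v trivial
    refine hcubic.mem_of_deg (hC.2.1 v hv) (fun h => ?_) hvf hve fun h => he.2 (h ▸ hfM)
    by_cases hf : f = e12
    · exact he12C (hf ▸ h)
    · exact (hcond2b ⟨h, (hMsub ⟨hfM, hf⟩).resolve_left fun h => hd21 v hv2 f h hvf⟩).2 hfM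
  have hu2C : u2 ∉ G.supp C := fun h => hcond2c.le
    ⟨⟨hCN2 u2 h hu2 _ σ.edge_mem hσm, (hN2 _ hσm).2 σ.edge_mem⟩,
      hC4N u2 hu2C4 _ σ.edge_mem hσm⟩
  have hu1C4 : u1 ∉ G.supp C4 := fun h => hne <|
    (hC3.subset_of_mem_supp hcubic hM hC4 hC3sub hC4sub hu1C3 h).antisymm
      (hC4.subset_of_mem_supp hcubic hM hC3 hC4sub hC3sub h hu1C3)
  obtain ⟨P, hP, hPt⟩ := exists_path₂ C2 hC2 he12C2 (fun ⟨e, he, h⟩ => hd12 u1 hu1 e he h) hu2 hC2N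
  obtain ⟨L, hL, hLt⟩ := exists_path₁ C1 hC1 he12C1 (fun ⟨e, he, h⟩ => hd21 u2 hu2 e he h) hu1 hC1N
  obtain ⟨LC, hLC, hLCt⟩ := exists_path₁ C hC he12C hu2C hu1C fun v hv =>
    (hcov v).elim (hCN1 v hv) (hCN2 v hv)
  obtain ⟨L4, hL4, hL4t⟩ := exists_path₂ C4 hC4 (fun h => (hC4sub h).2 he12M) hu1C4 hu2C4 hC4N
  refine F.exists_cover hP hL hLC hL4 ?_ ?_ ?_ ?_
  · rw [hPt, hLt]
    intro e h h'
    induction hi : G.inc e with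
    | _ v w =>
      exact hd12 v ⟨e, h'.1, by simp [hi]⟩ e h.1 (by simp [hi])
  · rw [hPt, hLt]
    exact fun e he => he.1.elim (fun h => .inr ⟨h, he⟩) fun h => .inl ⟨h, he⟩
  · obtain ⟨e, heC, he2⟩ := hcond2a
    have he : e ∈ (C1 ∪ C2) \ M := ⟨.inr he2, (hcond2b ⟨heC, he2⟩).2⟩
    exact ⟨e, hPt.ge ⟨he2, he⟩, hLCt.ge ⟨heC, he⟩⟩
  · rw [hPt, hL4t, hLCt]
    exact fun e h h' h'' => hcond2c.le ⟨⟨h''.1, h'.1⟩, h.1⟩
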